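/- arXiv:2408.10456 — 6 statements merged into one kernel-verified Lean document; each statement's English description precedes it below -/
import Mathlib

section
/- Let D ∈ X^n with n > k, and let D′ be obtained from D either by removing one element or by adding one element. Set q̃ = 1 − (1 − 1/n)^k and ã_m = q̃^{−1}·binom(k,m)·n^{−m}·(1 − 1/n)^{k−m} for m = 1,…,k. Then for every α > 1, the T-step fixed-size with-replacement DP-SGD mechanism satisfies D_α( M_{[0,T]}(D) ‖ M_{[0,T]}(D′) ) ≤ Σ_{t=0}^{T−1} (1/(α−1))·log[ Σ_{m=1}^{k} ã_m·H_{α,σ_t/m}(q̃) ]. -/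
open MeasureTheory Finset

noncomputable section

/-- `p`-dimensional Gaussian density with mean `μ` and covariance `s² I`. -/
def gaussND {p : ℕ} (μ : EuclideanSpace ℝ (Fin p)) (s : ℝ)
    (x : EuclideanSpace ℝ (Fin p)) : ℝ :=
  (2 * Real.pi * s ^ 2) ^ (-(p : ℝ) / 2) * Real.exp (-‖x - μ‖ ^ 2 / (2 * s ^ 2))

/-- one-dimensional Gaussian density with mean `μ` and variance `s²`. -/
def gauss1 (μ s θ : ℝ) : ℝ :=
  (2 * Real.pi * s ^ 2) ^ (-(1 : ℝ) / 2) * Real.exp (-(θ - μ) ^ 2 / (2 * s ^ 2))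

/-- Rényi divergence of order `α` between densities `P` and `Q` w.r.t. the measure `ν`. -/
def renyiDiv {Ω : Type*} [MeasurableSpace Ω] (ν : Measure Ω) (α : ℝ) (P Q : Ω → ℝ) : ℝ :=
  (α - 1)⁻¹ * Real.log (∫ x, (P x / Q x) ^ α * Q x ∂ν)

/-- `M_{σ,k} = ∫ (N_{1,σ²/4}/N_{0,σ²/4} − 1)^k N_{0,σ²/4}`. -/
def Mcoef (σ : ℝ) (k : ℕ) : ℝ :=
  ∫ θ : ℝ, (gauss1 1 (σ / 2) θ / gauss1 0 (σ / 2) θ - 1) ^ k * gauss1 0 (σ / 2) θ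

/-- `B̃_{σ,j}`. -/
def Btil (σ : ℝ) (j : ℕ) : ℝ :=
  if Even j then Mcoef σ j else Real.sqrt (Mcoef σ (j - 1) * Mcoef σ (j + 1))

/-- `H_{α,σ}(q)`. -/
def Hfun (α σ q : ℝ) : ℝ :=
  ∫ θ : ℝ, (q * (gauss1 1 (σ / 2) θ / gauss1 0 (σ / 2) θ) + (1 - q)) ^ α * gauss1 0 (σ / 2) θ

/-- `R̃_{α,σ,3}(q)`. -/
def Rtil3 (α σ q : ℝ) : ℝ :=
  if 3 < α then
    q ^ 3 * α * (α - 1) * |α - 2| *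
      ((∑ ℓ ∈ Finset.range (⌈α⌉₊ - 3 + 1),
          q ^ ℓ * ((⌈α⌉₊ - 3).factorial : ℝ) /
            (((⌈α⌉₊ - 3 - ℓ).factorial : ℝ) * ((3 + ℓ).factorial : ℝ)) * Btil σ (ℓ + 3)) +
        1 / 6 * Btil σ 3)
  else
    q ^ 3 * α * (α - 1) * |α - 2| * (1 / 6 * (1 - q) ^ (α - 3) * Btil σ 3)

/-- `F̃_{α,σ,k}`. -/
def Ftil (α σ : ℝ) (k : ℕ) : ℝ :=
  (α - 1) * α ^ (k - 1) *
      (if Even k then 4 * Mcoef σ k else 3 * Real.sqrt (Mcoef σ (k - 1) * Mcoef σ (k + 1))) +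
    (α - 1) * α ^ (k - 1) *
      ∑ j ∈ Finset.range (k + 1),
        (k.choose j : ℝ) *
          |α / (α - 1) * (∏ ℓ ∈ Finset.range j, (1 - (ℓ : ℝ) / α)) *
              (∏ ℓ ∈ Finset.range (k - j), (1 + ((ℓ : ℝ) - 1) / α)) - 1| *
          Btil σ k

/-- `Ẽ_{α,σ,m}(q)`. -/
def Etil (α σ : ℝ) (m : ℕ) (q : ℝ) : ℝ :=
  (q ^ m / (m.factorial : ℝ)) *
    ∑ j ∈ Finset.range (m + 1),
      (1 - q) ^ (-(α + (m : ℝ) - (j : ℝ) - 1)) * (m.choose j : ℝ) *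
        (∏ ℓ ∈ Finset.range j, |α - (ℓ : ℝ)|) *
        (∏ ℓ ∈ Finset.range (m - j), (α + (ℓ : ℝ) - 1)) *
        (if α ≤ (j : ℝ) then (1 - q) ^ (α - (j : ℝ)) * Btil σ m
         else Btil σ m + ∑ ℓ ∈ Finset.range (⌈α⌉₊ - j + 1),
           q ^ ℓ * ((⌈α⌉₊ - j).factorial : ℝ) * (m.factorial : ℝ) /
             (((⌈α⌉₊ - j - ℓ).factorial : ℝ) * ((m + ℓ).factorial : ℝ)) * Btil σ (ℓ + m))

/-- clipping to norm at most `C`. -/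
def clip {E : Type*} [NormedAddCommGroup E] [NormedSpace ℝ E] (C : ℝ) (x : E) : E :=
  (max 1 (‖x‖ / C))⁻¹ • x

/-- DP-SGD one-step mean for an index batch `b`. -/
def muStep {X : Type*} {p n : ℕ} (C η : ℝ) (k : ℕ)
    (g : EuclideanSpace ℝ (Fin p) → X → EuclideanSpace ℝ (Fin p))
    (θ : EuclideanSpace ℝ (Fin p)) (b : Finset (Fin n)) (D : Fin n → X) :
    EuclideanSpace ℝ (Fin p) :=
  θ - (η / (k : ℝ)) • ∑ i ∈ b, clip C (g θ (D i))

/-- fixed-size without-replacement DP-SGD transition density. -/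
def pFSwoR {X : Type*} {p : ℕ} (C η σ : ℝ) (k : ℕ)
    (g : EuclideanSpace ℝ (Fin p) → X → EuclideanSpace ℝ (Fin p))
    (n : ℕ) (D : Fin n → X) (θ θ' : EuclideanSpace ℝ (Fin p)) : ℝ :=
  ((n.choose k : ℝ))⁻¹ *
    ∑ b ∈ Finset.powersetCard k (Finset.univ : Finset (Fin n)),
      gaussND (muStep C η k g θ b D) (C * η * σ / (k : ℝ)) θ'

/-- fixed-size with-replacement DP-SGD transition density. -/
def pFSwR {X : Type*} {p : ℕ} (C η σ : ℝ) (k : ℕ)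
    (g : EuclideanSpace ℝ (Fin p) → X → EuclideanSpace ℝ (Fin p))
    (n : ℕ) (D : Fin n → X) (θ θ' : EuclideanSpace ℝ (Fin p)) : ℝ :=
  (((n : ℝ)) ^ k)⁻¹ *
    ∑ b : Fin k → Fin n,
      gaussND (θ - (η / (k : ℝ)) • ∑ j : Fin k, clip C (g θ (D (b j))))
        (C * η * σ / (k : ℝ)) θ'

/-- Poisson-subsampled DP-SGD transition density with sampling probability `k/n`. -/
def pPoisson {X : Type*} {p : ℕ} (C η σ : ℝ) (k : ℕ)
    (g : EuclideanSpace ℝ (Fin p) → X → EuclideanSpace ℝ (Fin p))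
    (n : ℕ) (D : Fin n → X) (θ θ' : EuclideanSpace ℝ (Fin p)) : ℝ :=
  ∑ S : Finset (Fin n),
    ((k : ℝ) / n) ^ S.card * (1 - (k : ℝ) / n) ^ (n - S.card) *
      gaussND (muStep C η k g θ S D) (C * η * σ / (k : ℝ)) θ'

/-- removing the `i`-th entry of a tuple. -/
def removeIdx {X : Type*} {n : ℕ} (i : Fin (n + 1)) (D : Fin (n + 1) → X) : Fin n → X :=
  fun j => D (i.succAbove j)

/-- `D'` is obtained from `D` by removing one element. -/
def IsRemoveOne {X : Type*} {m n : ℕ} (D : Fin m → X) (D' : Fin n → X) : Prop :=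
  ∃ (h : n + 1 = m) (i : Fin (n + 1)), D' = removeIdx i (fun j => D (Fin.cast h j))

/-- add/remove adjacency. -/
def AdjAddRemove {X : Type*} {m n : ℕ} (D : Fin m → X) (D' : Fin n → X) : Prop :=
  IsRemoveOne D D' ∨ IsRemoveOne D' D

/-- replace-one adjacency: the datasets differ in exactly one coordinate. -/
def AdjReplaceOne {X : Type*} {n : ℕ} (D D' : Fin n → X) : Prop :=
  ∃ i : Fin n, D i ≠ D' i ∧ ∀ j : Fin n, j ≠ i → D j = D' j

/-- joint density of the `T`-step Markov chain (coordinates `Θ_1,…,Θ_T`),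
started at the deterministic point `θ₀`, with transition densities `ptrans t`. -/
def chainDensity {E : Type*} (T : ℕ) (ptrans : ℕ → E → E → ℝ) (θ₀ : E)
    (x : Fin T → E) : ℝ :=
  ∏ t : Fin T,
    ptrans t
      (if 0 < (t : ℕ) then
        x ⟨(t : ℕ) - 1, Nat.lt_of_le_of_lt (Nat.sub_le _ _) t.isLt⟩
      else θ₀)
      (x t)

lemma convexOn_rpow_sub_rpow {α : ℝ} (hα : 1 < α) :
    ConvexOn ℝ (Set.Ici (1 : ℝ)) (fun x => x ^ α - x ^ (1 - α)) := by
  have hd : ∀ (β x : ℝ), 1 < x → HasDerivAt (fun x : ℝ => x ^ β) (β * x ^ (β - 1)) x :=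
    fun β x hx => Real.hasDerivAt_rpow_const (Or.inl (by positivity))
  apply convexOn_of_hasDerivWithinAt2_nonneg (convex_Ici 1)
    (f' := fun x => α * x ^ (α - 1) - (1 - α) * x ^ (1 - α - 1))
    (f'' := fun x => α * ((α - 1) * x ^ (α - 1 - 1)) -
      (1 - α) * ((1 - α - 1) * x ^ (1 - α - 1 - 1)))
  · refine ContinuousOn.sub ?_ ?_ <;> refine ContinuousOn.rpow_const continuousOn_id ?_ <;>
      intro x hx <;> left <;> simp at hx ⊢ <;> positivity
  · intro x hx
    rw [interior_Ici] at hx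
    exact ((hd α x hx).sub (hd (1 - α) x hx)).hasDerivWithinAt
  · intro x hx
    rw [interior_Ici] at hx
    exact (((hd _ x hx).const_mul _).sub ((hd _ x hx).const_mul _)).hasDerivWithinAt
  · intro x hx
    rw [interior_Ici] at hx
    have h : x ^ (1 - α - 1 - 1) ≤ x ^ (α - 1 - 1) :=
      Real.rpow_le_rpow_of_exponent_le (le_of_lt hx) (by linarith)
    have : 0 ≤ α * (α - 1) * (x ^ (α - 1 - 1) - x ^ (1 - α - 1 - 1)) :=
      mul_nonneg (by nlinarith) (by linarith)
    nlinarith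

lemma div_rpow_mul_eq {α a b : ℝ} (ha : 0 < a) (hb : 0 < b) :
    (a / b) ^ α * b = a * (b / a) ^ (1 - α) := by
  rw [Real.rpow_sub (by positivity), Real.rpow_one, Real.div_rpow ha.le hb.le,
    Real.div_rpow hb.le ha.le]
  have := Real.rpow_pos_of_pos ha α
  have := Real.rpow_pos_of_pos hb α
  field_simp

lemma mixture_swap_le_of_le {α f l q : ℝ} (hα : 1 < α) (hf : 0 < f) (hfl : f ≤ l)
    (hq0 : 0 ≤ q) (hq1 : q ≤ 1) :
    (f / ((1 - q) * f + q * l)) ^ α * ((1 - q) * f + q * l) +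
        (l / ((1 - q) * l + q * f)) ^ α * ((1 - q) * l + q * f) ≤
      (((1 - q) * f + q * l) / f) ^ α * f + (((1 - q) * l + q * f) / l) ^ α * l := by
  have hl : 0 < l := hf.trans_le hfl
  set y := (1 - q) * f + q * l with hy
  set y' := (1 - q) * l + q * f with hy'
  have hfy : f ≤ y := by nlinarith
  have hfy' : f ≤ y' := by nlinarith
  have hyl : y' ≤ l := by nlinarith
  have hyp : 0 < y := hf.trans_le hfy
  have hyp' : 0 < y' := hf.trans_le hfy'
  have hc := (convexOn_rpow_sub_rpow hα).2 (show (1 : ℝ) ∈ Set.Ici 1 by simp)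
    (show y / f ∈ Set.Ici (1 : ℝ) by simpa using (one_le_div hf).2 hfy)
    (show 0 ≤ 1 - f / y' by rw [sub_nonneg]; exact (div_le_one hyp').2 hfy')
    (show 0 ≤ f / y' by positivity) (by ring)
  have hb : (1 - f / y') * 1 + f / y' * (y / f) = l / y' := by
    field_simp
    rw [hy, hy']; ring
  simp only [smul_eq_mul, hb, Real.one_rpow, sub_self, mul_zero, zero_add] at hc
  have hc' := mul_le_mul_of_nonneg_left hc hyp'.le
  have e : y' * (f / y' * ((y / f) ^ α - (y / f) ^ (1 - α))) =
      f * (y / f) ^ α - f * (y / f) ^ (1 - α) := by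
    field_simp
  rw [e] at hc'
  have e3 := div_rpow_mul_eq (α := 1 - α) hl hyp'
  rw [sub_sub_cancel, mul_comm l, mul_comm _ y'] at e3
  rw [div_rpow_mul_eq hf hyp]
  linarith

lemma mixture_swap_le {α f l q : ℝ} (hα : 1 < α) (hf : 0 < f) (hl : 0 < l)
    (hq0 : 0 ≤ q) (hq1 : q ≤ 1) :
    (f / ((1 - q) * f + q * l)) ^ α * ((1 - q) * f + q * l) +
        (l / ((1 - q) * l + q * f)) ^ α * ((1 - q) * l + q * f) ≤
      (((1 - q) * f + q * l) / f) ^ α * f + (((1 - q) * l + q * f) / l) ^ α * l := by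
  rcases le_total f l with h | h
  · exact mixture_swap_le_of_le hα hf h hq0 hq1
  · have := mixture_swap_le_of_le hα hl h hq0 hq1
    linarith

lemma sum_div_rpow_mul_le {ι : Type*} (s : Finset ι) {α : ℝ} (hα : 1 < α)
    (w A B : ι → ℝ) (hw : ∀ i ∈ s, 0 ≤ w i) (hA : ∀ i ∈ s, 0 ≤ A i) (hB : ∀ i ∈ s, 0 < B i)
    (hpos : 0 < ∑ i ∈ s, w i * B i) :
    ((∑ i ∈ s, w i * A i) / ∑ i ∈ s, w i * B i) ^ α * (∑ i ∈ s, w i * B i) ≤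
      ∑ i ∈ s, w i * ((A i / B i) ^ α * B i) := by
  set S := ∑ i ∈ s, w i * B i with hS
  have h := (convexOn_rpow hα.le).map_sum_le (t := s) (w := fun i => w i * B i / S)
    (p := fun i => A i / B i)
    (fun i hi => div_nonneg (mul_nonneg (hw i hi) (hB i hi).le) hpos.le)
    (by rw [← Finset.sum_div, div_self hpos.ne'])
    (fun i hi => div_nonneg (hA i hi) (hB i hi).le)
  have e1 : ∑ i ∈ s, (w i * B i / S) • (A i / B i) = (∑ i ∈ s, w i * A i) / S := by
    rw [Finset.sum_div]
    refine Finset.sum_congr rfl fun i hi => ?_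
    have := (hB i hi).ne'
    simp only [smul_eq_mul]
    field_simp
  rw [e1] at h
  calc _ ≤ (∑ i ∈ s, (w i * B i / S) • (A i / B i) ^ α) * S :=
        mul_le_mul_of_nonneg_right h hpos.le
    _ = _ := by
        rw [Finset.sum_mul]
        refine Finset.sum_congr rfl fun i hi => ?_
        simp only [smul_eq_mul]
        field_simp

lemma sum_prod_comp {ι κ : Type*} [Fintype ι] [Fintype κ] [DecidableEq κ] (k : ℕ)
    (π : ι → κ) (w : ι → ℝ) (Φ : (Fin k → κ) → ℝ) :
    ∑ b : Fin k → ι, (∏ j, w (b j)) * Φ (fun j => π (b j)) =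
      ∑ b : Fin k → κ, (∏ j, ∑ x with π x = b j, w x) * Φ b := by
  classical
  rw [← Finset.sum_fiberwise (s := Finset.univ) (g := fun (b : Fin k → ι) j => π (b j))]
  refine Finset.sum_congr rfl fun b _ => ?_
  rw [Finset.prod_univ_sum, Finset.sum_mul]
  refine Finset.sum_congr ?_ ?_
  · ext x; simp [funext_iff]
  · intro x hx
    simp only [Fintype.mem_piFinset, Finset.mem_filter, Finset.mem_univ, true_and] at hx
    have : (fun j => π (x j)) = b := funext hx
    rw [this]

lemma sum_prod_bool (k : ℕ) (a b : ℝ) (φ : ℕ → ℝ) :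
    ∑ c : Fin k → Bool, (∏ j, if c j then a else b) * φ #{j | c j = true} =
      ∑ m ∈ Finset.range (k + 1), (k.choose m : ℝ) * a ^ m * b ^ (k - m) * φ m := by
  have h := Finset.sum_powerset_apply_card (fun m => a ^ m * b ^ (k - m) * φ m)
    (x := (Finset.univ : Finset (Fin k)))
  rw [Finset.powerset_univ] at h
  simp only [Finset.card_univ, Fintype.card_fin, nsmul_eq_mul] at h
  simp only [mul_assoc] at h ⊢
  rw [← h]
  refine Finset.sum_bij' (fun c _ => ({j | c j = true} : Finset (Fin k)))
    (fun S _ j => decide (j ∈ S)) (by simp) (by simp) (by simp) (by simp) ?_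
  intro c _
  rw [Finset.prod_ite]
  simp only [Finset.prod_const]
  have : #{j | ¬ c j = true} = k - #{j | c j = true} := by
    rw [Finset.filter_not, Finset.card_sdiff_of_subset (Finset.filter_subset _ _)]
    simp
  rw [this, mul_assoc]

/-- Isotropic Gaussian density on a finite-dimensional inner product space. -/
def gaussDensity {V : Type*} [NormedAddCommGroup V] [InnerProductSpace ℝ V]
    (μ : V) (s : ℝ) (x : V) : ℝ :=
  (2 * Real.pi * s ^ 2) ^ (-(Module.finrank ℝ V : ℝ) / 2) *
    Real.exp (-‖x - μ‖ ^ 2 / (2 * s ^ 2))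

/-- `α`-th moment of `1 - q + q L`, where `L` is the lognormal variable of mean `1` with log-variance
`v`. -/
def lognormalMixMoment (α q : ℝ) (v : NNReal) : ENNReal :=
  ∫⁻ x, ENNReal.ofReal ((1 - q + q * Real.exp (x - v / 2)) ^ α)
    ∂(ProbabilityTheory.gaussianReal 0 v)

lemma integrable_exp_add_gaussianReal (v : NNReal) (c : ℝ) :
    Integrable (fun x => Real.exp (x + c)) (ProbabilityTheory.gaussianReal 0 v) := by
  simpa [Real.exp_add] using
    (ProbabilityTheory.integrable_exp_mul_gaussianReal (μ := 0) (v := v) 1).mul_const (Real.exp c)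

lemma integral_exp_add_gaussianReal (v : NNReal) (c : ℝ) :
    ∫ x, Real.exp (x + c) ∂(ProbabilityTheory.gaussianReal 0 v) = Real.exp (v / 2 + c) := by
  have h := congrFun (ProbabilityTheory.mgf_fun_id_gaussianReal (μ := 0) (v := v)) 1
  simp only [ProbabilityTheory.mgf, one_mul, zero_add, one_pow, mul_one] at h
  simp_rw [Real.exp_add]
  rw [integral_mul_const, h]

lemma lintegral_rpow_ge {Ω : Type*} [MeasurableSpace Ω] (P : Measure Ω) [IsProbabilityMeasure P]
    {α : ℝ} (hα : 1 < α) {f : Ω → ENNReal} (hf : AEMeasurable f P) :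
    (∫⁻ x, f x ∂P) ^ α ≤ ∫⁻ x, f x ^ α ∂P := by
  have h := ENNReal.lintegral_mul_le_Lp_mul_Lq P (Real.HolderConjugate.conjExponent hα) hf
    (aemeasurable_const (b := (1 : ENNReal)))
  simp only [Pi.mul_apply, mul_one, ENNReal.one_rpow, lintegral_const, measure_univ] at h
  have h2 := ENNReal.rpow_le_rpow h (z := α) (by linarith)
  rwa [← ENNReal.rpow_mul, one_div_mul_cancel (by linarith), ENNReal.rpow_one] at h2

lemma mix_nonneg {q t : ℝ} (hq0 : 0 ≤ q) (hq1 : q ≤ 1) (ht : 0 ≤ t) : 0 ≤ 1 - q + q * t :=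
  add_nonneg (by linarith) (mul_nonneg hq0 ht)

lemma measurable_mix_exp (α q c : ℝ) :
    Measurable fun x : ℝ => ENNReal.ofReal ((1 - q + q * Real.exp (x - c)) ^ α) := by
  fun_prop

lemma lognormalMixMoment_mono {α q : ℝ} (hα : 1 < α) (hq0 : 0 ≤ q) (hq1 : q ≤ 1)
    {v w : NNReal} (h : v ≤ w) : lognormalMixMoment α q v ≤ lognormalMixMoment α q w := by
  obtain ⟨u, rfl⟩ := exists_add_of_le h
  unfold lognormalMixMoment
  have hconv := ProbabilityTheory.gaussianReal_conv_gaussianReal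
    (m₁ := 0) (m₂ := 0) (v₁ := v) (v₂ := u)
  rw [add_zero] at hconv
  rw [← hconv, Measure.lintegral_conv (measurable_mix_exp _ _ _)]
  refine lintegral_mono fun x => ?_
  have e : ∀ c : ℝ, ENNReal.ofReal ((1 - q + q * Real.exp c) ^ α) =
      (ENNReal.ofReal (1 - q + q * Real.exp c)) ^ α := fun c =>
    (ENNReal.ofReal_rpow_of_nonneg (mix_nonneg hq0 hq1 (Real.exp_pos _).le) (by linarith)).symm
  simp only [e]
  refine le_trans (le_of_eq ?_) (lintegral_rpow_ge _ hα (by fun_prop))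
  congr 1
  have hi : Integrable (fun y : ℝ => q * Real.exp (x + y - ((v + u : NNReal) : ℝ) / 2))
      (ProbabilityTheory.gaussianReal 0 u) := by
    refine (((integrable_exp_add_gaussianReal u (x - ((v + u : NNReal) : ℝ) / 2)).const_mul
      q)).congr (ae_of_all _ fun y => ?_)
    simp only; congr 2; ring
  have hi2 : Integrable (fun y : ℝ => 1 - q + q * Real.exp (x + y - ((v + u : NNReal) : ℝ) / 2))
      (ProbabilityTheory.gaussianReal 0 u) := (integrable_const _).add hi
  rw [← ofReal_integral_eq_lintegral_ofReal hi2
    (ae_of_all _ fun y => mix_nonneg hq0 hq1 (Real.exp_pos _).le)]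
  congr 1
  rw [integral_add (integrable_const _) hi, integral_const_mul]
  have : ∀ y : ℝ, x + y - ((v + u : NNReal) : ℝ) / 2 =
      y + (x - ((v + u : NNReal) : ℝ) / 2) := fun y => by ring
  simp_rw [this]
  rw [integral_exp_add_gaussianReal]
  simp only [integral_const, probReal_univ, one_smul]
  congr 3
  push_cast; ring

lemma one_le_lognormalMixMoment {α q : ℝ} (hα : 1 < α) (hq0 : 0 ≤ q) (hq1 : q ≤ 1)
    (v : NNReal) : 1 ≤ lognormalMixMoment α q v := by
  refine le_trans (le_of_eq ?_) (lognormalMixMoment_mono hα hq0 hq1 zero_le)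
  simp [lognormalMixMoment]

lemma lognormalMixMoment_ne_top {α q : ℝ} (hα : 1 < α) (hq0 : 0 ≤ q) (hq1 : q ≤ 1)
    (v : NNReal) : lognormalMixMoment α q v ≠ ⊤ := by
  have hi : Integrable (fun x : ℝ => (1 - q) + q * (Real.exp (α * x) * Real.exp (-(v / 2) * α)))
      (ProbabilityTheory.gaussianReal 0 v) :=
    (integrable_const _).add (((ProbabilityTheory.integrable_exp_mul_gaussianReal α).mul_const
      _).const_mul q)
  refine ne_top_of_le_ne_top hi.lintegral_lt_top.ne (lintegral_mono fun x => ?_)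
  refine ENNReal.ofReal_le_ofReal ?_
  have h := (convexOn_rpow hα.le).2 (show (1 : ℝ) ∈ Set.Ici 0 by simp)
    (show Real.exp (x - v / 2) ∈ Set.Ici 0 from (Real.exp_pos _).le)
    (show 0 ≤ 1 - q by linarith) hq0 (by ring)
  simp only [smul_eq_mul, mul_one, Real.one_rpow] at h
  refine h.trans (le_of_eq ?_)
  rw [← Real.exp_mul, ← Real.exp_add]
  congr 3; ring

lemma gaussDensity_pos {V : Type*} [NormedAddCommGroup V] [InnerProductSpace ℝ V]
    (μ : V) {s : ℝ} (hs : 0 < s) (x : V) : 0 < gaussDensity μ s x := by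
  unfold gaussDensity; positivity

lemma measurable_gaussDensity {V : Type*} [NormedAddCommGroup V] [InnerProductSpace ℝ V]
    [MeasurableSpace V] [BorelSpace V] (μ : V) (s : ℝ) : Measurable (gaussDensity μ s) := by
  unfold gaussDensity; fun_prop

lemma gaussDensity_div {V : Type*} [NormedAddCommGroup V] [InnerProductSpace ℝ V]
    (μ μ' : V) {s : ℝ} (hs : 0 < s) (x : V) :
    gaussDensity μ' s x / gaussDensity μ s x =
      Real.exp (inner ℝ ((s ^ 2)⁻¹ • (μ' - μ)) (x - μ) - ‖μ' - μ‖ ^ 2 / s ^ 2 / 2) := by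
  unfold gaussDensity
  rw [mul_div_mul_left _ _ (by positivity), ← Real.exp_sub]
  congr 1
  have : ‖x - μ'‖ ^ 2 = ‖x - μ‖ ^ 2 - 2 * inner ℝ (μ' - μ) (x - μ) + ‖μ' - μ‖ ^ 2 := by
    rw [show x - μ' = (x - μ) - (μ' - μ) by abel, norm_sub_sq_real,
      real_inner_comm]
  rw [this, real_inner_smul_left]
  field_simp
  ring

section Gaussian

variable {V : Type*} [NormedAddCommGroup V] [InnerProductSpace ℝ V] [FiniteDimensional ℝ V]
  [MeasurableSpace V] [BorelSpace V]

lemma integrable_gaussDensity (s : ℝ) (hs : 0 < s) : Integrable (gaussDensity (0 : V) s) := by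
  refine Integrable.const_mul ?_ _
  have hb : 0 < 1 / (2 * s ^ 2) := by positivity
  by_contra h
  have h2 := GaussianFourier.integral_rexp_neg_mul_sq_norm hb (V := V)
  have e : (fun x : V => Real.exp (-‖x - 0‖ ^ 2 / (2 * s ^ 2))) =
      fun x : V => Real.exp (-(1 / (2 * s ^ 2)) * ‖x‖ ^ 2) := by
    funext x; congr 1; rw [sub_zero]; ring
  rw [e] at h
  rw [integral_undef h] at h2
  have : 0 < (Real.pi / (1 / (2 * s ^ 2))) ^ ((Module.finrank ℝ V : ℝ) / 2) := by positivity
  linarith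

lemma charFun_inner_gaussDensity (a : V) {s : ℝ} (hs : 0 < s) (t : ℝ) :
    ∫ x, gaussDensity (0 : V) s x • Complex.exp (t * (inner ℝ a x : ℝ) * Complex.I) =
      Complex.exp (-(‖a‖ ^ 2 * s ^ 2 * t ^ 2 / 2 : ℝ)) := by
  have h := GaussianFourier.integral_cexp_neg_mul_sq_norm_add (V := V)
    (b := ((1 / (2 * s ^ 2) : ℝ) : ℂ)) (by rw [Complex.ofReal_re]; positivity) (t * Complex.I) a
  have e : ∀ x : V, gaussDensity (0 : V) s x • Complex.exp (t * (inner ℝ a x : ℝ) * Complex.I) =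
      (((2 * Real.pi * s ^ 2) ^ (-(Module.finrank ℝ V : ℝ) / 2) : ℝ) : ℂ) *
        Complex.exp (-((1 / (2 * s ^ 2) : ℝ) : ℂ) * ‖x‖ ^ 2 + t * Complex.I * (inner ℝ a x : ℝ)) := by
    intro x
    rw [Complex.real_smul, gaussDensity, Complex.ofReal_mul, mul_assoc, Complex.ofReal_exp,
      ← Complex.exp_add]
    congr 2
    rw [sub_zero]
    push_cast; ring
  simp_rw [e]
  rw [integral_const_mul, h, ← mul_assoc]
  have e2 : ((Real.pi : ℂ) / ((1 / (2 * s ^ 2) : ℝ) : ℂ)) ^ ((Module.finrank ℝ V : ℂ) / 2) =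
      (((2 * Real.pi * s ^ 2) ^ ((Module.finrank ℝ V : ℝ) / 2) : ℝ) : ℂ) := by
    rw [Complex.ofReal_cpow (by positivity)]
    push_cast
    congr 1
    field_simp
  rw [e2, ← Complex.ofReal_mul, ← Real.rpow_add (by positivity), neg_div, neg_add_cancel,
    Real.rpow_zero, Complex.ofReal_one, one_mul]
  congr 1
  have : (s : ℂ) ≠ 0 := by exact_mod_cast hs.ne'
  push_cast
  rw [mul_pow, Complex.I_sq]
  field_simp
  ring

lemma map_inner_gaussDensity (a : V) {s : ℝ} (hs : 0 < s) {v : NNReal}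
    (hv : (v : ℝ) = ‖a‖ ^ 2 * s ^ 2) :
    (volume.withDensity fun x : V => ENNReal.ofReal (gaussDensity 0 s x)).map
        (fun x => inner ℝ a x) = ProbabilityTheory.gaussianReal 0 v := by
  have hm := (measurable_gaussDensity (0 : V) s).ennreal_ofReal
  have : IsFiniteMeasure
      (volume.withDensity fun x : V => ENNReal.ofReal (gaussDensity 0 s x)) :=
    isFiniteMeasure_withDensity (integrable_gaussDensity s hs).lintegral_lt_top.ne
  apply Measure.ext_of_charFun
  funext t
  rw [charFun_apply_real, ProbabilityTheory.charFun_gaussianReal,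
    integral_map (by fun_prop) (by fun_prop),
    integral_withDensity_eq_integral_toReal_smul hm (by simp)]
  simp_rw [ENNReal.toReal_ofReal (gaussDensity_pos (0 : V) hs _).le]
  rw [charFun_inner_gaussDensity a hs]
  rw [← hv]
  congr 1
  push_cast; ring

lemma lintegral_mix_gaussDensity (α q : ℝ) (μ μ' : V) {s : ℝ} (hs : 0 < s) :
    ∫⁻ x, ENNReal.ofReal ((1 - q + q * (gaussDensity μ' s x / gaussDensity μ s x)) ^ α *
        gaussDensity μ s x) =
      lognormalMixMoment α q (‖μ' - μ‖ ^ 2 / s ^ 2).toNNReal := by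
  set v := (‖μ' - μ‖ ^ 2 / s ^ 2).toNNReal with hv
  have hvc : (v : ℝ) = ‖μ' - μ‖ ^ 2 / s ^ 2 := Real.coe_toNNReal _ (by positivity)
  rw [lognormalMixMoment, ← map_inner_gaussDensity ((s ^ 2)⁻¹ • (μ' - μ)) hs (v := v),
    lintegral_map (measurable_mix_exp _ _ _) (by fun_prop),
    lintegral_withDensity_eq_lintegral_mul _ (measurable_gaussDensity (0 : V) s).ennreal_ofReal
      (by fun_prop), ← lintegral_add_right_eq_self _ μ]
  · refine lintegral_congr fun x => ?_
    rw [gaussDensity_div μ μ' hs, add_sub_cancel_right, Pi.mul_apply, ← ENNReal.ofReal_mul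
      (gaussDensity_pos _ hs _).le, mul_comm, hvc]
    congr 2
    simp [gaussDensity]
  · rw [hvc, norm_smul, Real.norm_of_nonneg (by positivity)]
    field_simp

end Gaussian

lemma ofReal_Hfun {α q τ : ℝ} (hα : 1 < α) (hq0 : 0 ≤ q) (hq1 : q ≤ 1) (hτ : 0 < τ) :
    ENNReal.ofReal (Hfun α τ q) = lognormalMixMoment α q (4 / τ ^ 2).toNNReal := by
  have hg : ∀ μ x : ℝ, gauss1 μ (τ / 2) x = gaussDensity μ (τ / 2) x := by
    intro μ x; simp [gauss1, gaussDensity]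
  have hm := fun μ : ℝ => measurable_gaussDensity μ (τ / 2)
  have h0 := hm 0
  have h1 := hm 1
  have hpos : ∀ μ x : ℝ, 0 < gaussDensity μ (τ / 2) x := fun μ x =>
    gaussDensity_pos μ (by positivity) x
  have h := lintegral_mix_gaussDensity α q (0 : ℝ) 1 (s := τ / 2) (by positivity)
  have e : ‖(1 : ℝ) - 0‖ ^ 2 / (τ / 2) ^ 2 = 4 / τ ^ 2 := by
    rw [sub_zero, norm_one, div_pow]; field_simp; norm_num
  rw [e] at h
  rw [← h, Hfun, integral_eq_lintegral_of_nonneg_ae, ENNReal.ofReal_toReal]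
  · simp only [hg, add_comm]
  · have h2 := lognormalMixMoment_ne_top hα hq0 hq1 (4 / τ ^ 2).toNNReal
    rw [← h] at h2
    simpa only [hg, add_comm] using h2
  · refine ae_of_all _ fun x => mul_nonneg (Real.rpow_nonneg ?_ _) (by rw [hg]; exact (hpos _ _).le)
    rw [add_comm, hg, hg]
    exact mix_nonneg hq0 hq1 (div_pos (hpos _ _) (hpos _ _)).le
  · simp only [hg]
    exact Measurable.aestronglyMeasurable (by fun_prop)

lemma one_le_Hfun {α q τ : ℝ} (hα : 1 < α) (hq0 : 0 ≤ q) (hq1 : q ≤ 1) (hτ : 0 < τ) :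
    1 ≤ Hfun α τ q := by
  rw [← ENNReal.one_le_ofReal, ofReal_Hfun hα hq0 hq1 hτ]
  exact one_le_lognormalMixMoment hα hq0 hq1 _

section Component

variable {V : Type*} [NormedAddCommGroup V] [InnerProductSpace ℝ V] [FiniteDimensional ℝ V]
  [MeasurableSpace V] [BorelSpace V]

lemma lintegral_mix_left_le_Hfun {α q τ : ℝ} (hα : 1 < α) (hq0 : 0 ≤ q) (hq1 : q ≤ 1)
    (hτ : 0 < τ) (μ μ' : V) {s : ℝ} (hs : 0 < s) (h : ‖μ' - μ‖ * τ ≤ 2 * s) :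
    ∫⁻ x, ENNReal.ofReal
        ((((1 - q) * gaussDensity μ s x + q * gaussDensity μ' s x) / gaussDensity μ s x) ^ α *
          gaussDensity μ s x) ≤ ENNReal.ofReal (Hfun α τ q) := by
  rw [ofReal_Hfun hα hq0 hq1 hτ]
  have e : ∀ x, ((1 - q) * gaussDensity μ s x + q * gaussDensity μ' s x) / gaussDensity μ s x =
      1 - q + q * (gaussDensity μ' s x / gaussDensity μ s x) := by
    intro x
    have := (gaussDensity_pos μ hs x).ne'
    field_simp
  simp_rw [e]
  rw [lintegral_mix_gaussDensity α q μ μ' hs]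
  refine lognormalMixMoment_mono hα hq0 hq1 (Real.toNNReal_le_toNNReal ?_)
  rw [div_le_div_iff₀ (by positivity) (by positivity)]
  have := pow_le_pow_left₀ (by positivity) h 2
  nlinarith

lemma lintegral_mix_right_le_mix_left {α q : ℝ} (hα : 1 < α) (hq0 : 0 ≤ q) (hq1 : q ≤ 1)
    (μ μ' : V) {s : ℝ} (hs : 0 < s) :
    ∫⁻ x, ENNReal.ofReal
        ((gaussDensity μ s x / ((1 - q) * gaussDensity μ s x + q * gaussDensity μ' s x)) ^ α *
          ((1 - q) * gaussDensity μ s x + q * gaussDensity μ' s x)) ≤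
      ∫⁻ x, ENNReal.ofReal
        ((((1 - q) * gaussDensity μ s x + q * gaussDensity μ' s x) / gaussDensity μ s x) ^ α *
          gaussDensity μ s x) := by
  have hr : ∀ (ν ν' x : V), gaussDensity ν s (ν + ν' - x) = gaussDensity ν' s x := by
    intro ν ν' x
    unfold gaussDensity
    rw [show ν + ν' - x - ν = -(x - ν') by abel, norm_neg]
  have hr' : ∀ x : V, gaussDensity μ' s (μ + μ' - x) = gaussDensity μ s x := by
    intro x; rw [add_comm, hr]
  have hm := measurable_gaussDensity μ s
  have hm' := measurable_gaussDensity μ' s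
  have hp := gaussDensity_pos μ hs
  have hp' := gaussDensity_pos μ' hs
  set A : V → ℝ := fun x =>
    (gaussDensity μ s x / ((1 - q) * gaussDensity μ s x + q * gaussDensity μ' s x)) ^ α *
          ((1 - q) * gaussDensity μ s x + q * gaussDensity μ' s x) with hA
  set B : V → ℝ := fun x =>
    (((1 - q) * gaussDensity μ s x + q * gaussDensity μ' s x) / gaussDensity μ s x) ^ α *
          gaussDensity μ s x with hB
  have hAm : Measurable A := by fun_prop
  have hBm : Measurable B := by fun_prop
  have hmix : ∀ x, 0 ≤ (1 - q) * gaussDensity μ s x + q * gaussDensity μ' s x := fun x =>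
    add_nonneg (mul_nonneg (by linarith) (hp x).le) (mul_nonneg hq0 (hp' x).le)
  have hA0 : ∀ x, 0 ≤ A x := fun x =>
    mul_nonneg (Real.rpow_nonneg (div_nonneg (hp x).le (hmix x)) _) (hmix x)
  have hB0 : ∀ x, 0 ≤ B x := fun x =>
    mul_nonneg (Real.rpow_nonneg (div_nonneg (hmix x) (hp x).le) _) (hp x).le
  have key : ∀ x, A x + A (μ + μ' - x) ≤ B x + B (μ + μ' - x) := by
    intro x
    simp only [hA, hB, hr, hr']
    exact mixture_swap_le hα (hp x) (hp' x) hq0 hq1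
  have dbl : ∀ F : V → ℝ, Measurable F → (∀ x, 0 ≤ F x) →
      ∫⁻ x, ENNReal.ofReal (F x + F (μ + μ' - x)) = 2 * ∫⁻ x, ENNReal.ofReal (F x) := by
    intro F hF hF0
    simp_rw [ENNReal.ofReal_add (hF0 _) (hF0 _)]
    rw [lintegral_add_left (by fun_prop),
      lintegral_sub_left_eq_self (fun x => ENNReal.ofReal (F x)), two_mul]
  have h2 : 2 * ∫⁻ x, ENNReal.ofReal (A x) ≤ 2 * ∫⁻ x, ENNReal.ofReal (B x) := by
    rw [← dbl A hAm hA0, ← dbl B hBm hB0]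
    exact lintegral_mono fun x => ENNReal.ofReal_le_ofReal (key x)
  exact (ENNReal.mul_le_mul_iff_right (by norm_num) (by norm_num)).1 h2

/-- A bound for the `α`-divergence integral of two finite mixtures with common weights. -/
lemma lintegral_mixture_le {ι : Type*} (t : Finset ι) {α : ℝ} (hα : 1 < α) (w : ι → ℝ)
    (hw : ∀ i ∈ t, 0 ≤ w i) (hw1 : 0 < ∑ i ∈ t, w i) (P Q : ι → V → ℝ)
    (hP : ∀ i ∈ t, ∀ x, 0 ≤ P i x) (hQ : ∀ i ∈ t, ∀ x, 0 < Q i x)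
    (hPm : ∀ i, Measurable (P i)) (hQm : ∀ i, Measurable (Q i))
    (R : ι → ℝ) (hR : ∀ i ∈ t, 0 ≤ R i)
    (h : ∀ i ∈ t, ∫⁻ x, ENNReal.ofReal ((P i x / Q i x) ^ α * Q i x) ≤ ENNReal.ofReal (R i)) :
    ∫⁻ x, ENNReal.ofReal (((∑ i ∈ t, w i * P i x) / ∑ i ∈ t, w i * Q i x) ^ α *
        ∑ i ∈ t, w i * Q i x) ≤ ENNReal.ofReal (∑ i ∈ t, w i * R i) := by
  have hpos : ∀ x, 0 < ∑ i ∈ t, w i * Q i x := by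
    intro x
    obtain ⟨i, hi, hwi⟩ := Finset.exists_lt_of_sum_lt (f := fun _ => (0 : ℝ)) (g := w) (s := t)
      (by simpa using hw1)
    exact Finset.sum_pos' (fun j hj => mul_nonneg (hw j hj) (hQ j hj x).le)
      ⟨i, hi, mul_pos hwi (hQ i hi x)⟩
  calc _ ≤ ∫⁻ x, ENNReal.ofReal (∑ i ∈ t, w i * ((P i x / Q i x) ^ α * Q i x)) :=
        lintegral_mono fun x => ENNReal.ofReal_le_ofReal
          (sum_div_rpow_mul_le t hα w _ _ hw (fun i hi => hP i hi x) (fun i hi => hQ i hi x)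
            (hpos x))
    _ = ∫⁻ x, ∑ i ∈ t, ENNReal.ofReal (w i) *
          ENNReal.ofReal ((P i x / Q i x) ^ α * Q i x) := by
        refine lintegral_congr fun x => ?_
        rw [ENNReal.ofReal_sum_of_nonneg]
        · exact Finset.sum_congr rfl fun i hi => ENNReal.ofReal_mul (hw i hi)
        · intro i hi
          exact mul_nonneg (hw i hi) (mul_nonneg (Real.rpow_nonneg
            (div_nonneg (hP i hi x) (hQ i hi x).le) _) (hQ i hi x).le)
    _ = ∑ i ∈ t, ENNReal.ofReal (w i) *
          ∫⁻ x, ENNReal.ofReal ((P i x / Q i x) ^ α * Q i x) := by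
        have hm : ∀ i, Measurable fun x => ENNReal.ofReal ((P i x / Q i x) ^ α * Q i x) := by
          intro i
          have := hPm i
          have := hQm i
          fun_prop
        rw [lintegral_finsetSum _ fun i _ => (hm i).const_mul _]
        exact Finset.sum_congr rfl fun i _ => lintegral_const_mul _ (hm i)
    _ ≤ ∑ i ∈ t, ENNReal.ofReal (w i) * ENNReal.ofReal (R i) :=
        Finset.sum_le_sum fun i hi => by gcongr; exact h i hi
    _ = _ := by
        rw [ENNReal.ofReal_sum_of_nonneg fun i hi => mul_nonneg (hw i hi) (hR i hi)]
        exact Finset.sum_congr rfl fun i hi => (ENNReal.ofReal_mul (hw i hi)).symm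

end Component

lemma lintegral_chainDensity_le {E : Type*} [MeasureSpace E] [SigmaFinite (volume : Measure E)]
    (T : ℕ) (r : ℕ → E → E → ℝ) (hr : ∀ t x y, 0 ≤ r t x y) (B : ℕ → ENNReal)
    (hB : ∀ t < T, B t ≠ ⊤)
    (h : ∀ t < T, ∀ x, ∫⁻ y, ENNReal.ofReal (r t x y) ≤ B t) (θ₀ : E) :
    ∫⁻ x : Fin T → E, ENNReal.ofReal (chainDensity T r θ₀ x) ≤ ∏ t ∈ Finset.range T, B t := by
  induction T generalizing r B θ₀ with
  | zero =>
    simp [chainDensity, volume_pi]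
  | succ T ih =>
    rw [((volume_preserving_piFinSuccAbove (fun _ : Fin (T + 1) => E) 0).symm _
      ).lintegral_map_equiv]
    refine (lintegral_prod_le _).trans ?_
    have hs : ∀ (y : E) (z : Fin T → E), chainDensity (T + 1) r θ₀
        ((MeasurableEquiv.piFinSuccAbove (fun _ : Fin (T + 1) => E) 0).symm (y, z)) =
        r 0 θ₀ y * chainDensity T (fun t => r (t + 1)) y z := by
      intro y z
      unfold chainDensity
      rw [Fin.prod_univ_succ]
      congr 1
      refine Finset.prod_congr rfl fun t _ => ?_
      obtain ⟨t, ht⟩ := t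
      cases t with
      | zero => rfl
      | succ t => rfl
    simp_rw [hs, ENNReal.ofReal_mul (hr _ _ _)]
    rw [Finset.prod_range_succ', mul_comm]
    have hfin : ∏ t ∈ Finset.range T, B (t + 1) ≠ ⊤ :=
      ENNReal.prod_ne_top fun t ht => hB _ (by simpa using ht)
    calc _ ≤ ∫⁻ y, ENNReal.ofReal (r 0 θ₀ y) * ∏ t ∈ Finset.range T, B (t + 1) := by
          refine lintegral_mono fun y => ?_
          rw [lintegral_const_mul' _ _ ENNReal.ofReal_ne_top]
          gcongr
          exact ih (fun t => r (t + 1)) (fun t => hr _) (fun t => B (t + 1))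
            (fun t ht => hB _ (by omega)) (fun t ht => h _ (by omega)) y
      _ ≤ _ := by
          rw [lintegral_mul_const' _ _ hfin]
          gcongr
          exact h 0 (by omega) θ₀

lemma chainDensity_div_rpow_mul {E : Type*} (T : ℕ) (P Q : ℕ → E → E → ℝ) (α : ℝ)
    (hP : ∀ t x y, 0 ≤ P t x y) (hQ : ∀ t x y, 0 ≤ Q t x y) (θ₀ : E) (x : Fin T → E) :
    (chainDensity T P θ₀ x / chainDensity T Q θ₀ x) ^ α * chainDensity T Q θ₀ x =
      chainDensity T (fun t θ θ' => (P t θ θ' / Q t θ θ') ^ α * Q t θ θ') θ₀ x := by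
  unfold chainDensity
  rw [← Finset.prod_div_distrib,
    ← Real.finsetProd_rpow _ _ (fun t _ => div_nonneg (hP _ _ _) (hQ _ _ _)),
    ← Finset.prod_mul_distrib]

lemma renyiDiv_chainDensity_le {E : Type*} [MeasureSpace E] [SigmaFinite (volume : Measure E)]
    (T : ℕ) (P Q : ℕ → E → E → ℝ) {α : ℝ} (hα : 1 < α)
    (hP : ∀ t x y, 0 ≤ P t x y) (hQ : ∀ t x y, 0 ≤ Q t x y) (B : ℕ → ℝ)
    (hB : ∀ t < T, 1 ≤ B t)
    (h : ∀ t < T, ∀ θ, ∫⁻ y, ENNReal.ofReal ((P t θ y / Q t θ y) ^ α * Q t θ y) ≤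
      ENNReal.ofReal (B t)) (θ₀ : E) :
    renyiDiv volume α (chainDensity T P θ₀) (chainDensity T Q θ₀) ≤
      ∑ t ∈ Finset.range T, (α - 1)⁻¹ * Real.log (B t) := by
  have hB' : ∀ t ∈ Finset.range T, 1 ≤ B t := fun t ht => hB t (by simpa using ht)
  rw [renyiDiv, ← Finset.mul_sum]
  refine mul_le_mul_of_nonneg_left ?_ (inv_nonneg.2 (by linarith))
  rw [← Real.log_prod fun t ht => (zero_lt_one.trans_le (hB' t ht)).ne']
  have h1 : 1 ≤ ∏ t ∈ Finset.range T, B t := by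
    simpa using Finset.prod_le_prod (fun _ _ => zero_le_one) hB'
  simp_rw [chainDensity_div_rpow_mul T P Q α hP hQ]
  set F := chainDensity T (fun t θ θ' => (P t θ θ' / Q t θ θ') ^ α * Q t θ θ') θ₀ with hF
  have hr : ∀ t θ θ', 0 ≤ (P t θ θ' / Q t θ θ') ^ α * Q t θ θ' := fun t θ θ' =>
    mul_nonneg (Real.rpow_nonneg (div_nonneg (hP _ _ _) (hQ _ _ _)) _) (hQ _ _ _)
  have hF0 : ∀ x, 0 ≤ F x := fun x => Finset.prod_nonneg fun t _ => hr _ _ _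
  have hle : ∫ x, F x ≤ ∏ t ∈ Finset.range T, B t := by
    by_cases hm : AEStronglyMeasurable F volume
    · rw [integral_eq_lintegral_of_nonneg_ae (ae_of_all _ hF0) hm]
      refine ENNReal.toReal_le_of_le_ofReal (by linarith) ?_
      rw [ENNReal.ofReal_prod_of_nonneg fun t ht => zero_le_one.trans (hB' t ht)]
      exact lintegral_chainDensity_le T _ hr (fun t => ENNReal.ofReal (B t))
        (fun _ _ => ENNReal.ofReal_ne_top) h θ₀
    · rw [integral_undef fun hi => hm hi.aestronglyMeasurable]
      linarith
  rcases (integral_nonneg hF0 : 0 ≤ ∫ x, F x).eq_or_lt with h0 | h0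
  · rw [← h0, Real.log_zero]
    exact Real.log_nonneg h1
  · exact Real.log_le_log h0 hle

section Coupling

/-- Weights on pairs of a base index and a label in `{0, 1, 2}`: the index is uniform, and the label
is `0`, `1`, `2` with probability `1 - p`, `(N + 1)⁻¹`, `p - (N + 1)⁻¹`. -/
def labelWeight (N : ℕ) (p : ℝ) (x : Fin N × Fin 3) : ℝ :=
  (N : ℝ)⁻¹ * ![1 - p, ((N : ℝ) + 1)⁻¹, p - ((N : ℝ) + 1)⁻¹] x.2

lemma labelWeight_nonneg {N : ℕ} {p : ℝ} (hp : ((N : ℝ) + 1)⁻¹ ≤ p) (hp1 : p ≤ 1)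
    (x : Fin N × Fin 3) : 0 ≤ labelWeight N p x := by
  obtain ⟨i, c⟩ := x
  refine mul_nonneg (by positivity) ?_
  fin_cases c
  · simpa using hp1
  · simp; positivity
  · simpa using hp

/-- The number of entries with a nonzero label. -/
def labelCount {N k : ℕ} (b : Fin k → Fin N × Fin 3) : ℕ := #{j | (b j).2 ≠ 0}

lemma labelCount_eq_zero_iff {N k : ℕ} (b : Fin k → Fin N × Fin 3) :
    labelCount b = 0 ↔ ∀ j, (b j).2 = 0 := by
  simp [labelCount, Finset.filter_eq_empty_iff]

/-- Index obtained by sending label `1` to `i` and every other label to the base index. -/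
def relabel {N : ℕ} (i : Fin (N + 1)) (x : Fin N × Fin 3) : Fin (N + 1) :=
  if x.2 = 1 then i else i.succAbove x.1

lemma sum_labelWeight_base {N k : ℕ} (p : ℝ) (Φ : (Fin k → Fin N) → ℝ) :
    ∑ b : Fin k → Fin N × Fin 3, (∏ j, labelWeight N p (b j)) * Φ (fun j => (b j).1) =
      ((N : ℝ) ^ k)⁻¹ * ∑ b, Φ b := by
  rw [sum_prod_comp k Prod.fst (labelWeight N p) Φ, Finset.mul_sum]
  refine Finset.sum_congr rfl fun b _ => ?_
  congr 1
  rw [← inv_pow]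
  refine (Finset.prod_eq_pow_card (b := (N : ℝ)⁻¹) fun j _ => ?_).trans (by simp)
  rw [Finset.sum_filter, Fintype.sum_prod_type]
  simp [Fin.sum_univ_three, labelWeight, Finset.sum_add_distrib]
  ring

lemma sum_labelWeight_base_zero {N k : ℕ} (p : ℝ) (Φ : (Fin k → Fin N) → ℝ) :
    ∑ b : Fin k → Fin N × Fin 3 with labelCount b = 0,
        (∏ j, labelWeight N p (b j)) * Φ (fun j => (b j).1) =
      (1 - p) ^ k * (((N : ℝ) ^ k)⁻¹ * ∑ b, Φ b) := by
  have h := sum_prod_comp k (Prod.fst : Fin N × Fin 3 → Fin N)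
    (fun x => if x.2 = 0 then labelWeight N p x else 0) Φ
  rw [Finset.sum_filter]
  have e : ∀ b : Fin k → Fin N × Fin 3, (if labelCount b = 0 then
      (∏ j, labelWeight N p (b j)) * Φ (fun j => (b j).1) else 0) =
      (∏ j, if (b j).2 = 0 then labelWeight N p (b j) else 0) * Φ (fun j => (b j).1) := by
    intro b
    rw [Finset.prod_ite_zero]
    simp only [labelCount_eq_zero_iff, Finset.mem_univ, true_imp_iff, ite_mul, zero_mul]
  simp_rw [e]
  rw [h, ← mul_assoc, Finset.mul_sum]
  refine Finset.sum_congr rfl fun b _ => ?_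
  congr 1
  rw [← inv_pow, ← mul_pow]
  refine (Finset.prod_eq_pow_card (b := (1 - p) * (N : ℝ)⁻¹) fun j _ => ?_).trans (by simp)
  rw [Finset.sum_filter, Fintype.sum_prod_type]
  simp [Fin.sum_univ_three, labelWeight]
  ring

lemma sum_labelWeight_relabel {N k : ℕ} (hN : 0 < N) (p : ℝ) (i : Fin (N + 1))
    (Φ : (Fin k → Fin (N + 1)) → ℝ) :
    ∑ b : Fin k → Fin N × Fin 3, (∏ j, labelWeight N p (b j)) * Φ (fun j => relabel i (b j)) =
      ((((N + 1 : ℕ) : ℝ)) ^ k)⁻¹ * ∑ b, Φ b := by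
  rw [sum_prod_comp k (relabel i) (labelWeight N p) Φ, Finset.mul_sum]
  refine Finset.sum_congr rfl fun b _ => ?_
  congr 1
  rw [← inv_pow]
  refine (Finset.prod_eq_pow_card (b := (((N + 1 : ℕ) : ℝ))⁻¹) fun j _ => ?_).trans (by simp)
  rw [Finset.sum_filter, Fintype.sum_prod_type]
  have hN' : (N : ℝ) ≠ 0 := by positivity
  have hN1 : (N : ℝ) + 1 ≠ 0 := by positivity
  generalize b j = y
  rcases Fin.eq_self_or_eq_succAbove i y with rfl | ⟨l, rfl⟩
  · simp [labelWeight, relabel, Fin.succAbove_ne]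
    field_simp
  · simp [Fin.sum_univ_three, labelWeight, relabel, Finset.sum_add_distrib,
      (Fin.succAbove_ne _ _).symm]
    field_simp
    ring

lemma sum_labelWeight_count {N k : ℕ} (hN : 0 < N) (p : ℝ) (φ : ℕ → ℝ) :
    ∑ b : Fin k → Fin N × Fin 3, (∏ j, labelWeight N p (b j)) * φ (labelCount b) =
      ∑ m ∈ Finset.range (k + 1), (k.choose m : ℝ) * p ^ m * (1 - p) ^ (k - m) * φ m := by
  have h := sum_prod_comp k (fun x : Fin N × Fin 3 => decide (x.2 ≠ 0)) (labelWeight N p)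
    (fun c => φ #{j | c j = true})
  simp only [decide_eq_true_eq] at h
  have hN' : (N : ℝ) ≠ 0 := by positivity
  rw [← sum_prod_bool, show (∑ b : Fin k → Fin N × Fin 3, (∏ j, labelWeight N p (b j)) *
    φ (labelCount b)) = _ from h]
  refine Finset.sum_congr rfl fun c _ => ?_
  congr 1
  refine Finset.prod_congr rfl fun j _ => ?_
  rw [Finset.sum_filter, Fintype.sum_prod_type]
  cases c j <;> simp [Fin.sum_univ_three, labelWeight, hN']

lemma sum_labelWeight_count_ne_zero {N k : ℕ} (hN : 0 < N) (p : ℝ) (φ : ℕ → ℝ) :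
    ∑ b : Fin k → Fin N × Fin 3 with labelCount b ≠ 0,
        (∏ j, labelWeight N p (b j)) * φ (labelCount b) =
      ∑ m ∈ Finset.Icc 1 k, (k.choose m : ℝ) * p ^ m * (1 - p) ^ (k - m) * φ m := by
  have h := sum_labelWeight_count (k := k) hN p (fun m => if m = 0 then 0 else φ m)
  rw [Finset.sum_filter]
  simp only [ne_eq, ite_not]
  simp only [mul_ite, mul_zero] at h
  rw [h]
  symm
  refine (Finset.sum_congr rfl fun m hm => ?_).trans
    (Finset.sum_subset (s₁ := Finset.Icc 1 k) (fun m hm => ?_) fun m hm hm' => ?_)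
  · rw [if_neg (by have := Finset.mem_Icc.1 hm; omega)]
  · have := Finset.mem_Icc.1 hm
    exact Finset.mem_range.2 (by omega)
  · rw [Finset.mem_range] at hm
    rw [Finset.mem_Icc] at hm'
    rw [if_pos (by omega)]

lemma norm_clip_le {E : Type*} [NormedAddCommGroup E] [NormedSpace ℝ E] {C : ℝ} (hC : 0 < C)
    (x : E) : ‖clip C x‖ ≤ C := by
  have h1 : 0 < max 1 (‖x‖ / C) := lt_max_of_lt_left one_pos
  rw [clip, norm_smul, norm_inv, Real.norm_of_nonneg h1.le, inv_mul_le_iff₀ h1]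
  calc ‖x‖ = ‖x‖ / C * C := by field_simp
    _ ≤ _ := by gcongr; exact le_max_right _ _

lemma norm_sum_relabel_sub_le {E : Type*} [NormedAddCommGroup E] {N k : ℕ} {C : ℝ}
    (u : Fin (N + 1) → E) (hu : ∀ i, ‖u i‖ ≤ C) (i : Fin (N + 1))
    (b : Fin k → Fin N × Fin 3) :
    ‖∑ j, u (relabel i (b j)) - ∑ j, u (i.succAbove (b j).1)‖ ≤ 2 * C * labelCount b := by
  rw [← Finset.sum_sub_distrib]
  have h : ∀ j, ‖u (relabel i (b j)) - u (i.succAbove (b j).1)‖ ≤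
      if (b j).2 ≠ 0 then 2 * C else 0 := by
    intro j
    split_ifs with h0
    · exact (norm_sub_le _ _).trans (by linarith [hu (relabel i (b j)), hu (i.succAbove (b j).1)])
    · rw [not_not] at h0
      simp [relabel, h0]
  refine (norm_sum_le_of_le _ fun j _ => h j).trans (le_of_eq ?_)
  rw [← Finset.sum_filter, Finset.sum_const, nsmul_eq_mul, mul_comm, labelCount]

end Coupling

section OneStep

variable {V : Type*} [NormedAddCommGroup V] [InnerProductSpace ℝ V]

/-- Mixture over batches of `k` indices, drawn with replacement, of the Gaussian densities
produced by one gradient step with clipped gradients `u`. -/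
def batchDensity {n : ℕ} (k : ℕ) (c s : ℝ) (θ : V) (u : Fin n → V) (x : V) : ℝ :=
  ((n : ℝ) ^ k)⁻¹ * ∑ b : Fin k → Fin n, gaussDensity (θ - c • ∑ j, u (b j)) s x

/-- The weight of a labelled batch, conditioned on having a nonzero label. -/
def condWeight {N k : ℕ} (p : ℝ) (b : Fin k → Fin N × Fin 3) : ℝ :=
  (1 - (1 - p) ^ k)⁻¹ * ∏ j, labelWeight N p (b j)

lemma one_sub_pow_mem {p : ℝ} {k : ℕ} (hk : k ≠ 0) (hp0 : 0 < p) (hp1 : p ≤ 1) :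
    0 < 1 - (1 - p) ^ k ∧ 1 - (1 - p) ^ k ≤ 1 :=
  ⟨sub_pos.2 (pow_lt_one₀ (by linarith) (by linarith) hk),
    sub_le_self _ (pow_nonneg (by linarith) _)⟩

lemma sum_condWeight_base {N k : ℕ} (p : ℝ) (hq : 1 - (1 - p) ^ k ≠ 0)
    (Φ : (Fin k → Fin N) → ℝ) :
    ∑ b : Fin k → Fin N × Fin 3 with labelCount b ≠ 0, condWeight p b * Φ (fun j => (b j).1) =
      ((N : ℝ) ^ k)⁻¹ * ∑ b, Φ b := by
  have h := Finset.sum_filter_add_sum_filter_not Finset.univ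
    (fun b : Fin k → Fin N × Fin 3 => labelCount b = 0)
    (fun b => (∏ j, labelWeight N p (b j)) * Φ (fun j => (b j).1))
  rw [sum_labelWeight_base_zero, sum_labelWeight_base] at h
  simp only [condWeight, mul_assoc, ← Finset.mul_sum]
  rw [inv_mul_eq_iff_eq_mul₀ hq]
  linear_combination h

lemma sum_condWeight_count {N k : ℕ} (hN : 0 < N) (p : ℝ) (φ : ℕ → ℝ) :
    ∑ b : Fin k → Fin N × Fin 3 with labelCount b ≠ 0, condWeight p b * φ (labelCount b) =
      ∑ m ∈ Finset.Icc 1 k,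
        ((1 - (1 - p) ^ k)⁻¹ * (k.choose m : ℝ) * p ^ m * (1 - p) ^ (k - m)) * φ m := by
  simp only [condWeight, mul_assoc, ← Finset.mul_sum]
  rw [sum_labelWeight_count_ne_zero hN, Finset.mul_sum, Finset.mul_sum]
  simp only [mul_assoc]

lemma sum_condWeight {N k : ℕ} (hN : 0 < N) (p : ℝ) (hq : 1 - (1 - p) ^ k ≠ 0) :
    ∑ b : Fin k → Fin N × Fin 3 with labelCount b ≠ 0, condWeight p b = 1 := by
  have h := sum_condWeight_base (N := N) p hq fun _ => 1
  have hN' : (N : ℝ) ≠ 0 := by positivity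
  simpa [hN'] using h

lemma sum_condWeight_mix {N k : ℕ} (hN : 0 < N) (p : ℝ) (hq : 1 - (1 - p) ^ k ≠ 0)
    (i : Fin (N + 1)) (Φ : (Fin k → Fin (N + 1)) → ℝ) :
    ∑ b : Fin k → Fin N × Fin 3 with labelCount b ≠ 0, condWeight p b *
        ((1 - (1 - (1 - p) ^ k)) * Φ (fun j => i.succAbove (b j).1) +
          (1 - (1 - p) ^ k) * Φ (fun j => relabel i (b j))) =
      (((N + 1 : ℕ) : ℝ) ^ k)⁻¹ * ∑ b, Φ b := by
  have h := Finset.sum_filter_add_sum_filter_not Finset.univ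
    (fun b : Fin k → Fin N × Fin 3 => labelCount b = 0)
    (fun b => (∏ j, labelWeight N p (b j)) * Φ (fun j => relabel i (b j)))
  have h0 : ∑ b : Fin k → Fin N × Fin 3 with labelCount b = 0,
      (∏ j, labelWeight N p (b j)) * Φ (fun j => relabel i (b j)) =
      ∑ b : Fin k → Fin N × Fin 3 with labelCount b = 0,
      (∏ j, labelWeight N p (b j)) * Φ (fun j => i.succAbove (b j).1) := by
    refine Finset.sum_congr rfl fun b hb => ?_
    have hb' := (labelCount_eq_zero_iff b).1 (Finset.mem_filter.1 hb).2
    simp [relabel, hb']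
  rw [h0, sum_labelWeight_relabel hN, sum_labelWeight_base_zero p
    (fun b => Φ (fun j => i.succAbove (b j)))] at h
  have h1 := sum_condWeight_base p hq (fun b : Fin k → Fin N => Φ (fun j => i.succAbove (b j)))
  rw [← h, ← h1]
  simp only [mul_add, Finset.sum_add_distrib, sub_sub_cancel]
  congr 1
  · rw [Finset.mul_sum]
    exact Finset.sum_congr rfl fun b _ => by ring
  · refine Finset.sum_congr rfl fun b _ => ?_
    rw [condWeight]
    field_simp

/-- The bound on the one-step `α`-moment for with-replacement sampling. -/
def stepBound (k : ℕ) (p α σ : ℝ) : ℝ :=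
  ∑ m ∈ Finset.Icc 1 k,
    ((1 - (1 - p) ^ k)⁻¹ * (k.choose m : ℝ) * p ^ m * (1 - p) ^ (k - m)) *
      Hfun α (σ / (m : ℝ)) (1 - (1 - p) ^ k)

lemma one_le_stepBound {k : ℕ} (hk : k ≠ 0) {p α σ : ℝ} (hα : 1 < α) (hp0 : 0 < p) (hp1 : p ≤ 1)
    (hσ : 0 < σ) : 1 ≤ stepBound k p α σ := by
  obtain ⟨hq0, hq1⟩ := one_sub_pow_mem hk hp0 hp1
  have h := sum_condWeight_count (N := 1) (k := k) one_pos p fun _ => 1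
  simp only [mul_one] at h
  rw [sum_condWeight one_pos p hq0.ne'] at h
  rw [h, stepBound]
  refine Finset.sum_le_sum fun m hm => le_mul_of_one_le_right ?_ ?_
  · have := sub_nonneg.2 hp1
    positivity
  · have hm0 : 0 < m := (Finset.mem_Icc.1 hm).1
    exact one_le_Hfun hα hq0.le hq1 (by positivity)

lemma batchDensity_succAbove {N k : ℕ} {p : ℝ} (hq : 1 - (1 - p) ^ k ≠ 0) (c s : ℝ) (θ : V)
    (u : Fin (N + 1) → V) (i : Fin (N + 1)) (x : V) :
    batchDensity k c s θ (fun j => u (i.succAbove j)) x =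
      ∑ b : Fin k → Fin N × Fin 3 with labelCount b ≠ 0, condWeight p b *
        gaussDensity (θ - c • ∑ j, u (i.succAbove (b j).1)) s x :=
  (sum_condWeight_base p hq fun b : Fin k → Fin N =>
    gaussDensity (θ - c • ∑ j, u (i.succAbove (b j))) s x).symm

lemma batchDensity_eq_mix {N k : ℕ} (hN : 0 < N) {p : ℝ} (hq : 1 - (1 - p) ^ k ≠ 0) (c s : ℝ)
    (θ : V) (u : Fin (N + 1) → V) (i : Fin (N + 1)) (x : V) :
    batchDensity k c s θ u x =
      ∑ b : Fin k → Fin N × Fin 3 with labelCount b ≠ 0, condWeight p b *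
        ((1 - (1 - (1 - p) ^ k)) * gaussDensity (θ - c • ∑ j, u (i.succAbove (b j).1)) s x +
          (1 - (1 - p) ^ k) * gaussDensity (θ - c • ∑ j, u (relabel i (b j))) s x) :=
  (sum_condWeight_mix hN p hq i fun b => gaussDensity (θ - c • ∑ j, u (b j)) s x).symm

lemma condWeight_nonneg {N k : ℕ} {p : ℝ} (hk : k ≠ 0) (hp : ((N : ℝ) + 1)⁻¹ ≤ p) (hp1 : p ≤ 1)
    (b : Fin k → Fin N × Fin 3) : 0 ≤ condWeight p b :=
  mul_nonneg (inv_nonneg.2 (one_sub_pow_mem hk (lt_of_lt_of_le (by positivity) hp) hp1).1.le)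
    (Finset.prod_nonneg fun j _ => labelWeight_nonneg hp hp1 (b j))

lemma norm_step_sub_le {N k : ℕ} {C η σ : ℝ} (hC : 0 < C) (hη : 0 < η) (hσ : 0 < σ) (hk : k ≠ 0)
    (u : Fin (N + 1) → V) (hu : ∀ i, ‖u i‖ ≤ C) (i : Fin (N + 1)) (θ : V)
    (b : Fin k → Fin N × Fin 3) (hb : labelCount b ≠ 0) :
    ‖(θ - (η / k) • ∑ j, u (relabel i (b j))) - (θ - (η / k) • ∑ j, u (i.succAbove (b j).1))‖ *
      (σ / labelCount b) ≤ 2 * (C * η * σ / k) := by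
  have h := norm_sum_relabel_sub_le u hu i b
  rw [sub_sub_sub_cancel_left, ← smul_sub, norm_smul, norm_sub_rev,
    Real.norm_of_nonneg (by positivity)]
  have hb' : (0 : ℝ) < labelCount b := by positivity
  calc _ ≤ η / k * (2 * C * labelCount b) * (σ / labelCount b) := by gcongr
    _ = _ := by field_simp

variable [FiniteDimensional ℝ V] [MeasurableSpace V] [BorelSpace V]

lemma lintegral_batchDensity_remove_le {N k : ℕ} {C η σ α p : ℝ} (hN : 0 < N) (hα : 1 < α)
    (hC : 0 < C) (hη : 0 < η) (hσ : 0 < σ) (hk : k ≠ 0) (hp : ((N : ℝ) + 1)⁻¹ ≤ p) (hp1 : p ≤ 1)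
    (u : Fin (N + 1) → V) (hu : ∀ i, ‖u i‖ ≤ C) (i : Fin (N + 1)) (θ : V) :
    ∫⁻ x, ENNReal.ofReal ((batchDensity k (η / k) (C * η * σ / k) θ u x /
          batchDensity k (η / k) (C * η * σ / k) θ (fun j => u (i.succAbove j)) x) ^ α *
        batchDensity k (η / k) (C * η * σ / k) θ (fun j => u (i.succAbove j)) x) ≤
      ENNReal.ofReal (stepBound k p α σ) := by
  have hp0 : 0 < p := lt_of_lt_of_le (by positivity) hp
  obtain ⟨hq0, hq1⟩ := one_sub_pow_mem hk hp0 hp1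
  have hs : 0 < C * η * σ / k := by positivity
  simp only [batchDensity_succAbove hq0.ne' _ _ _ u i, batchDensity_eq_mix hN hq0.ne' _ _ _ u i]
  rw [stepBound, ← sum_condWeight_count hN p fun m => Hfun α (σ / m) (1 - (1 - p) ^ k)]
  have hτ : ∀ b ∈ ({b | labelCount b ≠ 0} : Finset (Fin k → Fin N × Fin 3)),
      0 < σ / labelCount b := fun b hb => by
    have : (0 : ℝ) < labelCount b := by
      exact_mod_cast Nat.pos_of_ne_zero (Finset.mem_filter.1 hb).2
    positivity
  refine lintegral_mixture_le _ hα (condWeight p) (fun b _ => condWeight_nonneg hk hp hp1 b)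
    (by rw [sum_condWeight hN p hq0.ne']; exact one_pos)
    (fun b x => (1 - (1 - (1 - p) ^ k)) *
        gaussDensity (θ - (η / k : ℝ) • ∑ j, u (i.succAbove (b j).1)) (C * η * σ / k) x +
      (1 - (1 - p) ^ k) *
        gaussDensity (θ - (η / k : ℝ) • ∑ j, u (relabel i (b j))) (C * η * σ / k) x)
    (fun b => gaussDensity (θ - (η / k : ℝ) • ∑ j, u (i.succAbove (b j).1)) (C * η * σ / k))
    (fun b _ x => ?_) (fun b _ x => gaussDensity_pos _ hs x)
    (fun b => ?_) (fun b => measurable_gaussDensity _ _)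
    (fun b => Hfun α (σ / labelCount b) (1 - (1 - p) ^ k)) (fun b hb => ?_) (fun b hb => ?_)
  · exact add_nonneg (mul_nonneg (sub_nonneg.2 hq1) (gaussDensity_pos _ hs x).le)
      (mul_nonneg hq0.le (gaussDensity_pos _ hs x).le)
  · exact ((measurable_gaussDensity _ _).const_mul _).add
      ((measurable_gaussDensity _ _).const_mul _)
  · exact zero_le_one.trans (one_le_Hfun hα hq0.le hq1 (hτ b hb))
  · exact lintegral_mix_left_le_Hfun hα hq0.le hq1 (hτ b hb) _ _ hs
      (norm_step_sub_le hC hη hσ hk u hu i θ b (Finset.mem_filter.1 hb).2)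

lemma lintegral_batchDensity_add_le {N k : ℕ} {C η σ α p : ℝ} (hN : 0 < N) (hα : 1 < α)
    (hC : 0 < C) (hη : 0 < η) (hσ : 0 < σ) (hk : k ≠ 0) (hp : ((N : ℝ) + 1)⁻¹ ≤ p) (hp1 : p ≤ 1)
    (u : Fin (N + 1) → V) (hu : ∀ i, ‖u i‖ ≤ C) (i : Fin (N + 1)) (θ : V) :
    ∫⁻ x, ENNReal.ofReal
        ((batchDensity k (η / k) (C * η * σ / k) θ (fun j => u (i.succAbove j)) x /
          batchDensity k (η / k) (C * η * σ / k) θ u x) ^ α *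
        batchDensity k (η / k) (C * η * σ / k) θ u x) ≤
      ENNReal.ofReal (stepBound k p α σ) := by
  have hp0 : 0 < p := lt_of_lt_of_le (by positivity) hp
  obtain ⟨hq0, hq1⟩ := one_sub_pow_mem hk hp0 hp1
  have hs : 0 < C * η * σ / k := by positivity
  simp only [batchDensity_succAbove hq0.ne' _ _ _ u i, batchDensity_eq_mix hN hq0.ne' _ _ _ u i]
  rw [stepBound, ← sum_condWeight_count hN p fun m => Hfun α (σ / m) (1 - (1 - p) ^ k)]
  have hτ : ∀ b ∈ ({b | labelCount b ≠ 0} : Finset (Fin k → Fin N × Fin 3)),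
      0 < σ / labelCount b := fun b hb => by
    have : (0 : ℝ) < labelCount b := by
      exact_mod_cast Nat.pos_of_ne_zero (Finset.mem_filter.1 hb).2
    positivity
  refine lintegral_mixture_le _ hα (condWeight p) (fun b _ => condWeight_nonneg hk hp hp1 b)
    (by rw [sum_condWeight hN p hq0.ne']; exact one_pos)
    (fun b => gaussDensity (θ - (η / k : ℝ) • ∑ j, u (i.succAbove (b j).1)) (C * η * σ / k))
    (fun b x => (1 - (1 - (1 - p) ^ k)) *
        gaussDensity (θ - (η / k : ℝ) • ∑ j, u (i.succAbove (b j).1)) (C * η * σ / k) x +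
      (1 - (1 - p) ^ k) *
        gaussDensity (θ - (η / k : ℝ) • ∑ j, u (relabel i (b j))) (C * η * σ / k) x)
    (fun b _ x => (gaussDensity_pos _ hs x).le) (fun b _ x => ?_)
    (fun b => measurable_gaussDensity _ _) (fun b => ?_)
    (fun b => Hfun α (σ / labelCount b) (1 - (1 - p) ^ k)) (fun b hb => ?_) (fun b hb => ?_)
  · exact add_pos_of_nonneg_of_pos (mul_nonneg (sub_nonneg.2 hq1) (gaussDensity_pos _ hs x).le)
      (mul_pos hq0 (gaussDensity_pos _ hs x))
  · exact ((measurable_gaussDensity _ _).const_mul _).add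
      ((measurable_gaussDensity _ _).const_mul _)
  · exact zero_le_one.trans (one_le_Hfun hα hq0.le hq1 (hτ b hb))
  · exact (lintegral_mix_right_le_mix_left hα hq0.le hq1 _ _ hs).trans
      (lintegral_mix_left_le_Hfun hα hq0.le hq1 (hτ b hb) _ _ hs
        (norm_step_sub_le hC hη hσ hk u hu i θ b (Finset.mem_filter.1 hb).2))

lemma pFSwR_eq_batchDensity {X : Type*} {p : ℕ} (C η σ : ℝ) (k : ℕ)
    (g : EuclideanSpace ℝ (Fin p) → X → EuclideanSpace ℝ (Fin p)) (n : ℕ) (D : Fin n → X)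
    (θ θ' : EuclideanSpace ℝ (Fin p)) :
    pFSwR C η σ k g n D θ θ' =
      batchDensity k (η / k) (C * η * σ / k) θ (fun j => clip C (g θ (D j))) θ' := by
  simp only [pFSwR, batchDensity, gaussND, gaussDensity, finrank_euclideanSpace, Fintype.card_fin]

lemma pFSwR_nonneg {X : Type*} {p : ℕ} (C η σ : ℝ) (k : ℕ)
    (g : EuclideanSpace ℝ (Fin p) → X → EuclideanSpace ℝ (Fin p)) (n : ℕ) (D : Fin n → X)
    (θ θ' : EuclideanSpace ℝ (Fin p)) : 0 ≤ pFSwR C η σ k g n D θ θ' := by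
  unfold pFSwR gaussND
  positivity

end OneStep

/-- T-step fixed-size with-replacement RDP upper bound, add/remove adjacency. -/
theorem stmt5 {X : Type*} {pd : ℕ} (hpd : 1 ≤ pd)
    (C : ℝ) (hC : 0 < C) (T : ℕ) (ηs σs : ℕ → ℝ)
    (hη : ∀ t < T, 0 < ηs t) (hσ : ∀ t < T, 0 < σs t)
    (k : ℕ) (hk : 1 ≤ k)
    (g : EuclideanSpace ℝ (Fin pd) → X → EuclideanSpace ℝ (Fin pd))
    {nD nD' : ℕ} (D : Fin nD → X) (D' : Fin nD' → X)
    (hadj : AdjAddRemove D D') (hnk : k < nD)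
    (θ₀ : EuclideanSpace ℝ (Fin pd)) (α : ℝ) (hα : 1 < α) :
    renyiDiv volume α
        (chainDensity T (fun t θ θ' => pFSwR C (ηs t) (σs t) k g nD D θ θ') θ₀)
        (chainDensity T (fun t θ θ' => pFSwR C (ηs t) (σs t) k g nD' D' θ θ') θ₀) ≤
      ∑ t ∈ Finset.range T,
        (α - 1)⁻¹ *
          Real.log (∑ m ∈ Finset.Icc 1 k,
            ((1 - (1 - (nD : ℝ)⁻¹) ^ k)⁻¹ * (k.choose m : ℝ) * ((nD : ℝ) ^ m)⁻¹ *
                (1 - (nD : ℝ)⁻¹) ^ (k - m)) *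
              Hfun α (σs t / (m : ℝ)) (1 - (1 - (nD : ℝ)⁻¹) ^ k)) := by
  have hk0 : k ≠ 0 := by omega
  have hn2 : (1 : ℝ) < nD := by exact_mod_cast lt_of_le_of_lt hk hnk
  have hp0 : 0 < (nD : ℝ)⁻¹ := by positivity
  have hp1 : (nD : ℝ)⁻¹ < 1 := inv_lt_one_of_one_lt₀ hn2
  simp_rw [← inv_pow]
  refine renyiDiv_chainDensity_le T _ _ hα (fun _ _ _ => pFSwR_nonneg ..)
    (fun _ _ _ => pFSwR_nonneg ..) (fun t => stepBound k (nD : ℝ)⁻¹ α (σs t))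
    (fun t ht => one_le_stepBound hk0 hα hp0 hp1.le (hσ t ht)) (fun t ht θ => ?_) θ₀
  simp_rw [pFSwR_eq_batchDensity]
  rcases hadj with ⟨h, i, rfl⟩ | ⟨h, i, rfl⟩
  · subst h
    exact lintegral_batchDensity_remove_le (by omega) hα hC (hη t ht) (hσ t ht) hk0
      (by push_cast; exact le_rfl) hp1.le (fun j => clip C (g θ (D j)))
      (fun j => norm_clip_le hC _) i θ
  · subst h
    exact lintegral_batchDensity_add_le (by omega) hα hC (hη t ht) (hσ t ht) hk0
      (by gcongr; linarith) hp1.le (fun j => clip C (g θ (D' j)))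
      (fun j => norm_clip_le hC _) i θ
end
end

section
/- Suppose there exist θ* ∈ ℝ^p and d, d′ ∈ X such that Clip(g(θ*,d)) = −Clip(g(θ*,d′)) and ‖Clip(g(θ*,d))‖₂ = ‖Clip(g(θ*,d′))‖₂ = C (the clipped gradients at d and d′ are anti-parallel and saturate the clipping threshold). Then for every integer α ≥ 2 and every integer N ≥ 2, letting a_m = binom(k,m)·N^{−m}·(1 − 1/N)^{k−m}, the supremum over triples (θ, D, D′) with D ∈ X^N and D′ obtained from D by removing or adding one element, of the one-step Rényi divergence D_α( p^{FSwR}(·|θ,D) ‖ p^{FSwR}(·|θ,D′) ), is at least (1/(α−1))·log[ Σ_{m_1,…,m_α = 0}^{k} a_{m_1}···a_{m_α}·exp( (4/σ²)·Σ_{1≤i<j≤α} m_i·m_j ) ]. -/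
open MeasureTheory Finset

noncomputable section

theorem sum_apply_card_filter_eq_zero {M : Type*} [Semiring M] (k n : ℕ) (F : ℕ → M) :
    ∑ b : Fin k → Fin (n + 1), F #{j | b j = 0} =
      ∑ m : Fin (k + 1), (k.choose m : M) * (n : M) ^ (k - (m : ℕ)) * F m := by
  classical
  have hfib : ∀ S : Finset (Fin k),
      ∑ b : Fin k → Fin (n + 1) with ({j | b j = 0} : Finset (Fin k)) = S, F #{j | b j = 0} =
        (n : M) ^ (k - #S) * F #S := by
    intro S
    have hset : ({b : Fin k → Fin (n + 1) | ({j | b j = 0} : Finset (Fin k)) = S} :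
        Finset (Fin k → Fin (n + 1))) =
        Fintype.piFinset fun j => if j ∈ S then {0} else {0}ᶜ := by
      ext b
      simp only [mem_filter, mem_univ, true_and, Fintype.mem_piFinset, Finset.ext_iff]
      refine forall_congr' fun j => ?_
      by_cases hj : j ∈ S <;> simp [hj]
    have hcard : #(Fintype.piFinset fun j : Fin k =>
        if j ∈ S then ({0} : Finset (Fin (n + 1))) else {0}ᶜ) = n ^ (k - #S) := by
      rw [Fintype.card_piFinset]
      simp only [apply_ite Finset.card, card_singleton, card_compl, Fintype.card_fin,
        Nat.add_sub_cancel]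
      rw [prod_ite]
      simp [filter_not, card_sdiff]
    rw [sum_congr rfl fun b hb => by rw [(mem_filter.mp hb).2], sum_const, hset, hcard,
      nsmul_eq_mul, Nat.cast_pow]
  rw [← sum_fiberwise univ fun b : Fin k → Fin (n + 1) => ({j | b j = 0} : Finset (Fin k)),
    sum_congr rfl fun S _ => hfib S, ← powerset_univ,
    sum_powerset_apply_card fun m => (n : M) ^ (k - m) * F m, card_univ, Fintype.card_fin,
    ← Fin.sum_univ_eq_sum_range
      fun m => k.choose m • ((n : M) ^ (k - m) * F m)]
  simp [nsmul_eq_mul, mul_assoc]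

theorem Fin.sq_sum_eq {R : Type*} [CommRing R] (n : ℕ) (m : Fin n → R) :
    (∑ i, m i) ^ 2 = ∑ i, m i ^ 2 + 2 * ∑ i, ∑ j ∈ Ioi i, m i * m j := by
  induction n with
  | zero => simp
  | succ n ih =>
    have h := ih fun i => m i.succ
    simp only [Fin.sum_univ_succ, Fin.sum_Ioi_zero, Fin.sum_Ioi_succ, ← mul_sum] at h ⊢
    linear_combination h

section gaussND

variable {p : ℕ} {s : ℝ}

theorem gaussND_pos (hs : 0 < s) (μ x : EuclideanSpace ℝ (Fin p)) : 0 < gaussND μ s x := by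
  unfold gaussND
  positivity

theorem integrable_gaussND (hs : 0 < s) (μ : EuclideanSpace ℝ (Fin p)) :
    Integrable (gaussND μ s) := by
  have h := (GaussianFourier.integrable_cexp_neg_mul_sq_norm_add (V := EuclideanSpace ℝ (Fin p))
    (b := ((1 / (2 * s ^ 2) : ℝ) : ℂ)) (by rw [Complex.ofReal_re]; positivity) 0 0).norm
  have h' := (h.comp_sub_right μ).const_mul ((2 * Real.pi * s ^ 2) ^ (-(p : ℝ) / 2))
  refine h'.congr (.of_forall fun x => ?_)
  simp only [gaussND, Complex.norm_exp]
  congr 2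
  norm_cast
  simp
  ring

theorem integral_gaussND (hs : 0 < s) (μ : EuclideanSpace ℝ (Fin p)) :
    ∫ x, gaussND μ s x = 1 := by
  have h := GaussianFourier.integral_rexp_neg_mul_sq_norm (V := EuclideanSpace ℝ (Fin p))
    (b := 1 / (2 * s ^ 2)) (by positivity)
  have hx : ∀ x, gaussND μ s x = (2 * Real.pi * s ^ 2) ^ (-(p : ℝ) / 2) *
      Real.exp (-(1 / (2 * s ^ 2)) * ‖x - μ‖ ^ 2) := by
    intro x
    rw [gaussND]
    congr 2
    ring
  simp only [hx]
  rw [integral_const_mul,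
    integral_sub_right_eq_self (fun x => Real.exp (-(1 / (2 * s ^ 2)) * ‖x‖ ^ 2)) μ, h,
    finrank_euclideanSpace_fin, show Real.pi / (1 / (2 * s ^ 2)) = 2 * Real.pi * s ^ 2 by
      field_simp, ← Real.rpow_add (by positivity)]
  rw [neg_div, neg_add_cancel, Real.rpow_zero]

theorem prod_gaussND_div_mul_gaussND (hs : 0 < s) {α : ℕ} (m : Fin α → ℝ)
    (μ u x : EuclideanSpace ℝ (Fin p)) :
    (∏ i, gaussND (μ - m i • u) s x / gaussND μ s x) * gaussND μ s x =
      Real.exp (‖u‖ ^ 2 / s ^ 2 * ∑ i, ∑ j ∈ Ioi i, m i * m j) *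
        gaussND (μ - (∑ i, m i) • u) s x := by
  have hnorm : ∀ t : ℝ, ‖x - (μ - t • u)‖ ^ 2 =
      ‖x - μ‖ ^ 2 + 2 * t * inner ℝ (x - μ) u + t ^ 2 * ‖u‖ ^ 2 := by
    intro t
    rw [show x - (μ - t • u) = (x - μ) + t • u by abel, norm_add_sq_real, inner_smul_right,
      norm_smul, mul_pow, Real.norm_eq_abs, sq_abs]
    ring
  have hratio : ∀ t : ℝ, gaussND (μ - t • u) s x / gaussND μ s x =
      Real.exp (-(2 * inner ℝ (x - μ) u / (2 * s ^ 2)) * t - ‖u‖ ^ 2 / (2 * s ^ 2) * t ^ 2) := by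
    intro t
    rw [gaussND, gaussND, mul_div_mul_left _ _ (by positivity), ← Real.exp_sub, hnorm]
    congr 1
    ring
  rw [prod_congr rfl fun i _ => hratio (m i), ← Real.exp_sum, sum_sub_distrib, ← mul_sum,
    ← mul_sum, gaussND, gaussND, mul_left_comm, mul_left_comm (Real.exp _), ← Real.exp_add,
    ← Real.exp_add, hnorm]
  congr 2
  have h := Fin.sq_sum_eq α m
  field_simp
  linear_combination ‖u‖ ^ 2 * h

theorem integral_mixture_gaussND_div_pow_mul (hs : 0 < s) {ι : Type*} [Fintype ι] (α : ℕ)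
    (a m : ι → ℝ) (μ u : EuclideanSpace ℝ (Fin p)) :
    ∫ x, ((∑ l, a l * gaussND (μ - m l • u) s x) / gaussND μ s x) ^ α * gaussND μ s x =
      ∑ f : Fin α → ι, (∏ i, a (f i)) *
        Real.exp (‖u‖ ^ 2 / s ^ 2 * ∑ i, ∑ j ∈ Ioi i, m (f i) * m (f j)) := by
  classical
  have hx : ∀ x, ((∑ l, a l * gaussND (μ - m l • u) s x) / gaussND μ s x) ^ α * gaussND μ s x =
      ∑ f : Fin α → ι, ((∏ i, a (f i)) *
        Real.exp (‖u‖ ^ 2 / s ^ 2 * ∑ i, ∑ j ∈ Ioi i, m (f i) * m (f j))) *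
          gaussND (μ - (∑ i, m (f i)) • u) s x := by
    intro x
    rw [sum_div, Fintype.sum_pow, sum_mul]
    refine sum_congr rfl fun f _ => ?_
    simp only [mul_div_assoc]
    rw [prod_mul_distrib, mul_assoc, prod_gaussND_div_mul_gaussND hs fun i => m (f i), mul_assoc]
  simp only [hx]
  rw [integral_finsetSum _ fun f _ => (integrable_gaussND hs _).const_mul _]
  simp only [integral_const_mul, integral_gaussND hs, mul_one]

end gaussND

section pFSwR

variable {X : Type*} {p : ℕ} (C η σ : ℝ) (k : ℕ)
  (g : EuclideanSpace ℝ (Fin p) → X → EuclideanSpace ℝ (Fin p)) (d d' : X)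
  (θ x : EuclideanSpace ℝ (Fin p))

theorem pFSwR_const {n : ℕ} (hn : n ≠ 0) :
    pFSwR C η σ k g n (fun _ => d') θ x =
      gaussND (θ - (η / (k : ℝ)) • k • clip C (g θ d')) (C * η * σ / (k : ℝ)) x := by
  have : (n : ℝ) ≠ 0 := Nat.cast_ne_zero.mpr hn
  simp [pFSwR, this]

theorem pFSwR_cons_const (n : ℕ) :
    pFSwR C η σ k g (n + 1) (Fin.cons d fun _ => d') θ x =
      ∑ m : Fin (k + 1), ((k.choose m : ℝ) * (((n + 1 : ℕ) : ℝ) ^ (m : ℕ))⁻¹ *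
          (1 - ((n + 1 : ℕ) : ℝ)⁻¹) ^ (k - (m : ℕ))) *
        gaussND (θ - (η / (k : ℝ)) • k • clip C (g θ d') -
          ((m : ℕ) : ℝ) • (η / (k : ℝ)) • (clip C (g θ d) - clip C (g θ d')))
          (C * η * σ / (k : ℝ)) x := by
  have hsum : ∀ b : Fin k → Fin (n + 1),
      ∑ j, clip C (g θ ((Fin.cons d fun _ => d' : Fin (n + 1) → X) (b j))) =
        k • clip C (g θ d') +
          (#{j | b j = 0} : ℝ) • (clip C (g θ d) - clip C (g θ d')) := by
    intro b
    have hterm : ∀ j, clip C (g θ ((Fin.cons d fun _ => d' : Fin (n + 1) → X) (b j))) =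
        clip C (g θ d') + if b j = 0 then clip C (g θ d) - clip C (g θ d') else 0 := by
      intro j
      refine Fin.cases ?_ (fun i => ?_) (b j) <;> simp
    simp only [hterm, sum_add_distrib, ← sum_filter, sum_const, card_univ, Fintype.card_fin,
      Nat.cast_smul_eq_nsmul]
  simp only [pFSwR, hsum]
  rw [sum_apply_card_filter_eq_zero k n fun m => gaussND (θ - (η / (k : ℝ)) •
    (k • clip C (g θ d') + (m : ℝ) • (clip C (g θ d) - clip C (g θ d')))) (C * η * σ / (k : ℝ)) x,
    mul_sum]
  refine sum_congr rfl fun m _ => ?_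
  rw [smul_add, ← sub_sub, smul_comm (η / (k : ℝ)) ((m : ℕ) : ℝ), ← mul_assoc]
  congr 1
  have hN : ((n + 1 : ℕ) : ℝ) ≠ 0 := Nat.cast_ne_zero.mpr n.succ_ne_zero
  have hm : (m : ℕ) + (k - m) = k := Nat.add_sub_of_le (Nat.lt_succ_iff.mp m.isLt)
  rw [show 1 - ((n + 1 : ℕ) : ℝ)⁻¹ = n * ((n + 1 : ℕ) : ℝ)⁻¹ by field_simp; simp, mul_pow, inv_pow]
  nth_rewrite 1 [← hm]
  rw [pow_add, mul_inv]
  ring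

end pFSwR

/-- fixed-size with-replacement RDP worst-case lower bound. -/
theorem stmt6 {X : Type*} {pd : ℕ} (hpd : 1 ≤ pd)
    (C η σ : ℝ) (hC : 0 < C) (hη : 0 < η) (hσ : 0 < σ)
    (k : ℕ) (hk : 1 ≤ k)
    (g : EuclideanSpace ℝ (Fin pd) → X → EuclideanSpace ℝ (Fin pd))
    (θstar : EuclideanSpace ℝ (Fin pd)) (d d' : X)
    (hanti : clip C (g θstar d) = -clip C (g θstar d'))
    (hnorm : ‖clip C (g θstar d)‖ = C) (hnorm' : ‖clip C (g θstar d')‖ = C)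
    (α : ℕ) (hα : 2 ≤ α) (N : ℕ) (hN : 2 ≤ N) :
    ∃ (θ : EuclideanSpace ℝ (Fin pd)) (nD' : ℕ) (D : Fin N → X) (D' : Fin nD' → X),
      AdjAddRemove D D' ∧
        ((α : ℝ) - 1)⁻¹ *
            Real.log (∑ f : Fin α → Fin (k + 1),
              (∏ i, ((k.choose (f i : ℕ) : ℝ) * ((N : ℝ) ^ (f i : ℕ))⁻¹ *
                  (1 - (N : ℝ)⁻¹) ^ (k - (f i : ℕ)))) *
                Real.exp (4 / σ ^ 2 *
                  ∑ i : Fin α, ∑ j ∈ Finset.Ioi i, ((f i : ℕ) : ℝ) * ((f j : ℕ) : ℝ))) ≤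
          renyiDiv volume (α : ℝ) (pFSwR C η σ k g N D θ) (pFSwR C η σ k g nD' D' θ) := by
  obtain ⟨n, rfl⟩ : ∃ n, N = n + 1 := ⟨N - 1, by omega⟩
  have hn : n ≠ 0 := by omega
  have hk' : (0 : ℝ) < k := by exact_mod_cast hk
  have hs : 0 < C * η * σ / (k : ℝ) := by positivity
  refine ⟨θstar, n, Fin.cons d fun _ => d', fun _ => d', Or.inl ⟨rfl, 0, ?_⟩, ?_⟩
  · funext j
    simp [removeIdx]
  have hu : ‖(η / (k : ℝ)) • (clip C (g θstar d) - clip C (g θstar d'))‖ ^ 2 /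
      (C * η * σ / (k : ℝ)) ^ 2 = 4 / σ ^ 2 := by
    rw [hanti, show -clip C (g θstar d') - clip C (g θstar d') =
      (-2 : ℝ) • clip C (g θstar d') by module, norm_smul, norm_smul, hnorm', Real.norm_eq_abs,
      abs_of_pos (by positivity), Real.norm_eq_abs, abs_neg, abs_two]
    field_simp
    norm_num
  simp only [renyiDiv, Real.rpow_natCast, pFSwR_const C η σ k g d' θstar _ hn, pFSwR_cons_const]
  rw [integral_mixture_gaussND_div_pow_mul hs α _ (fun m : Fin (k + 1) => ((m : ℕ) : ℝ)), hu]
end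
end

section
/- Let n ≥ 2 and k ≥ 1 be integers. Let B′_1,…,B′_k be i.i.d. uniform random variables on {0,…,n−2}, let N be Binomial(k, 1/n), and let Π be a uniformly random permutation of (1,…,k), with B′ = (B′_1,…,B′_k), N, and Π mutually independent. For i = 1,…,k define B_i = n−1 if Π(j) = i for some j ≤ N, and B_i = B′_i otherwise. Then B_1,…,B_k are i.i.d. uniform random variables on {0,…,n−1}; equivalently, P((B_1,…,B_k) = b) = n^{−k} for every b ∈ {0,…,n−1}^k. -/
open MeasureTheory
open scoped ENNReal

/-- The number of permutations carrying the first `#S` indices onto `S`. -/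
theorem card_perm_image_initial (k : ℕ) (S : Finset (Fin k)) :
    (Finset.univ.filter fun π : Equiv.Perm (Fin k) =>
      ∀ j : Fin k, (j : ℕ) < S.card ↔ π j ∈ S).card = S.card.factorial * (k - S.card).factorial := by
  classical
  have hS : S.card ≤ k := by simpa using S.card_le_univ
  have hcard : Fintype.card {j : Fin k // (j : ℕ) < S.card} = Fintype.card {j : Fin k // j ∈ S} := by
    rw [Fintype.card_subtype, Fin.card_filter_val_lt, Fintype.card_coe, min_eq_right hS]
  obtain ⟨e⟩ := Fintype.card_eq.mp hcard
  have hσ (j : Fin k) : (j : ℕ) < S.card ↔ e.extendSubtype j ∈ S := by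
    by_cases h : (j : ℕ) < S.card
    · exact iff_of_true h (e.extendSubtype_mem j h)
    · exact iff_of_false h (e.extendSubtype_not_mem j h)
  set σ := e.extendSubtype
  let f : Fin k → Bool := fun i => decide (i ∈ S)
  have key := DomMulAct.stabilizer_card f
  have hprod : ∏ i : Bool, (Fintype.card {a // f a = i}).factorial =
      S.card.factorial * (k - S.card).factorial := by
    simp [f, Fintype.card_subtype, Finset.filter_not, Finset.card_sdiff]
  rw [hprod] at key
  rw [← key, ← Fintype.card_subtype]
  refine Fintype.card_congr ((Equiv.mulRight σ⁻¹).subtypeEquiv fun π => ?_)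
  have hf : f ∘ (π * σ⁻¹) = f ↔ ∀ i, π (σ⁻¹ i) ∈ S ↔ i ∈ S := by
    rw [funext_iff]
    exact forall_congr' fun i => decide_eq_decide
  refine Iff.trans ?_ hf.symm
  constructor
  · intro h i
    rw [← h, hσ]
    simp
  · intro h j
    rw [hσ, ← h]
    simp

/-- The conditions on the underlying data that produce the outcome `b`. -/
theorem overwrite_eq_iff {n k : ℕ} (last : Fin n) (b' b : Fin k → Fin n) (m : ℕ) (hm : m ≤ k)
    (π : Equiv.Perm (Fin k)) (hb' : ∀ i, b' i ≠ last) :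
    (∀ i, (if ∃ j : Fin k, (j : ℕ) < m ∧ π j = i then last else b' i) = b i) ↔
      (∀ i, b i ≠ last → b' i = b i) ∧ m = (Finset.univ.filter fun i => b i = last).card ∧
        ∀ j : Fin k, (j : ℕ) < (Finset.univ.filter fun i => b i = last).card ↔
          π j ∈ Finset.univ.filter fun i => b i = last := by
  have hiff (i : Fin k) : (∃ j : Fin k, (j : ℕ) < m ∧ π j = i) ↔ (π.symm i : ℕ) < m :=
    ⟨by rintro ⟨j, hj, rfl⟩; simpa using hj, fun h => ⟨_, h, by simp⟩⟩
  simp only [hiff]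
  constructor
  · intro h
    have hlast (j : Fin k) : (j : ℕ) < m ↔ b (π j) = last := by
      rw [← h (π j)]
      by_cases hj : (j : ℕ) < m <;> simp [hj, hb']
    have hcard : m = (Finset.univ.filter fun i => b i = last).card := by
      rw [← Finset.card_map π.symm.toEmbedding]
      have : (Finset.univ.filter fun i => b i = last).map π.symm.toEmbedding =
          Finset.univ.filter fun j : Fin k => (j : ℕ) < m := by
        ext j
        simp [hlast, Finset.mem_map_equiv]
      rw [this, Fin.card_filter_val_lt, min_eq_right hm]
    refine ⟨fun i hi => ?_, hcard, fun j => ?_⟩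
    · have := h i
      split_ifs at this
      · exact absurd this.symm hi
      · exact this
    · rw [← hcard, hlast]
      simp
  · rintro ⟨h, rfl, hπ⟩ i
    have := hπ (π.symm i)
    simp only [Equiv.apply_symm_apply, Finset.mem_filter, Finset.mem_univ, true_and] at this
    split_ifs with hi
    · exact (this.mp hi).symm
    · exact h i fun hb => hi (this.mpr hb)

/-- The number of functions avoiding `last` that agree with `b` wherever `b` avoids `last`. -/
theorem card_agree_avoid {n k : ℕ} (last : Fin n) (b : Fin k → Fin n) :
    (Finset.univ.filter fun b' : Fin k → Fin n =>
      (∀ i, b' i ≠ last) ∧ ∀ i, b i ≠ last → b' i = b i).card =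
        (n - 1) ^ (Finset.univ.filter fun i => b i = last).card := by
  have : (Finset.univ.filter fun b' : Fin k → Fin n =>
      (∀ i, b' i ≠ last) ∧ ∀ i, b i ≠ last → b' i = b i) =
      Fintype.piFinset fun i => if b i = last then Finset.univ.erase last else {b i} := by
    ext b'
    simp only [Finset.mem_filter, Finset.mem_univ, true_and, Fintype.mem_piFinset, ← forall_and]
    refine forall_congr' fun i => ?_
    split_ifs with hi
    · simp [hi]
    · simp only [Finset.mem_singleton]
      exact ⟨fun h => h.2 hi, fun h => ⟨h ▸ hi, fun _ => h⟩⟩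
  rw [this, Fintype.card_piFinset, ← Finset.prod_const, Finset.prod_filter]
  refine Finset.prod_congr rfl fun i _ => ?_
  split_ifs <;> simp

/-- The product of the number of favourable triples and their common probability. -/
theorem favourable_mass (n k s : ℕ) (hn : 2 ≤ n) (hs : s ≤ k) :
    (((n - 1) ^ s * (s.factorial * (k - s).factorial) : ℕ) : ℝ≥0∞) *
      (((((n - 1 : ℕ) : ℝ≥0∞)) ^ k)⁻¹ * ((k.choose s : ℝ≥0∞) * ((n : ℝ≥0∞)⁻¹) ^ s *
        (1 - (n : ℝ≥0∞)⁻¹) ^ (k - s)) * ((k.factorial : ℝ≥0∞))⁻¹) = (((n : ℝ≥0∞)) ^ k)⁻¹ := by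
  obtain ⟨d, rfl⟩ := Nat.exists_eq_add_of_le hs
  obtain ⟨a, rfl⟩ : ∃ a, n = a + 1 := ⟨n - 1, by omega⟩
  have ha : (a : ℝ) ≠ 0 := by
    have : a ≠ 0 := by omega
    exact_mod_cast this
  have ha' : ((a + 1 : ℕ) : ℝ) ≠ 0 := by positivity
  have hle : ((a + 1 : ℕ) : ℝ≥0∞)⁻¹ ≤ 1 := by
    rw [ENNReal.inv_le_one]
    exact_mod_cast Nat.le_add_left 1 a
  have hf : (((s + d).factorial : ℕ) : ℝ) ≠ 0 := by positivity
  have hchoose := congrArg (Nat.cast (R := ℝ)) (Nat.add_choose_mul_factorial_mul_factorial s d)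
  have htop : ((a + 1 : ℕ) : ℝ≥0∞)⁻¹ ≠ ⊤ := by simp
  have hpow : ((a : ℝ≥0∞) ^ (s + d))⁻¹ ≠ ⊤ := by
    have : a ≠ 0 := by omega
    simp [this]
  have hfac : (((s + d).factorial : ℕ) : ℝ≥0∞)⁻¹ ≠ ⊤ := by simp [Nat.factorial_ne_zero]
  have hsub : 1 - ((a + 1 : ℕ) : ℝ≥0∞)⁻¹ ≠ ⊤ := ENNReal.sub_ne_top (by simp)
  simp only [Nat.add_sub_cancel, Nat.add_sub_cancel_left]
  rw [← ENNReal.toReal_eq_toReal_iff'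
    (by
      refine ENNReal.mul_ne_top (ENNReal.natCast_ne_top _) (ENNReal.mul_ne_top
        (ENNReal.mul_ne_top hpow (ENNReal.mul_ne_top (ENNReal.mul_ne_top
          (ENNReal.natCast_ne_top _) (ENNReal.pow_ne_top htop)) (ENNReal.pow_ne_top hsub))) hfac))
    (by simp)]
  simp only [ENNReal.toReal_mul, ENNReal.toReal_inv, ENNReal.toReal_pow, ENNReal.toReal_natCast,
    ENNReal.toReal_sub_of_le hle ENNReal.one_ne_top, ENNReal.toReal_one]
  have h1 : (1 : ℝ) - ((a + 1 : ℕ) : ℝ)⁻¹ = a / (a + 1 : ℕ) := by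
    field_simp
    push_cast
    ring
  rw [h1, div_pow, inv_pow, Nat.choose_symm_add]
  push_cast at *
  field_simp
  rw [← hchoose]
  ring

/-- decomposition of uniform fixed-size sampling with replacement,
Lemma: `B_1,…,B_k` are i.i.d. uniform on `{0,…,n−1}`. -/
theorem stmt9 {Ω : Type*} [MeasurableSpace Ω] (P : Measure Ω) [IsProbabilityMeasure P]
    (n k : ℕ) (hn : 2 ≤ n) (hk : 1 ≤ k)
    (B' B : Ω → Fin k → Fin n) (N : Ω → ℕ) (Prm : Ω → Equiv.Perm (Fin k))
    (hB'meas : ∀ b : Fin k → Fin n, MeasurableSet {ω | B' ω = b})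
    (hNmeas : ∀ m : ℕ, MeasurableSet {ω | N ω = m})
    (hPrmmeas : ∀ π : Equiv.Perm (Fin k), MeasurableSet {ω | Prm ω = π})
    (last : Fin n) (hlast : (last : ℕ) = n - 1)
    (hB'range : ∀ ω i, B' ω i ≠ last)
    (hB'unif : ∀ b : Fin k → Fin n, (∀ i, b i ≠ last) →
      P {ω | B' ω = b} = ((((n - 1 : ℕ) : ℝ≥0∞)) ^ k)⁻¹)
    (hNrange : ∀ ω, N ω ≤ k)
    (hNdist : ∀ m : ℕ, m ≤ k → P {ω | N ω = m} =
      (k.choose m : ℝ≥0∞) * ((n : ℝ≥0∞)⁻¹) ^ m * (1 - (n : ℝ≥0∞)⁻¹) ^ (k - m))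
    (hPrmunif : ∀ π : Equiv.Perm (Fin k), P {ω | Prm ω = π} = ((k.factorial : ℝ≥0∞))⁻¹)
    (hindep : ∀ (b : Fin k → Fin n) (m : ℕ) (π : Equiv.Perm (Fin k)),
      P ({ω | B' ω = b} ∩ {ω | N ω = m} ∩ {ω | Prm ω = π}) =
        P {ω | B' ω = b} * P {ω | N ω = m} * P {ω | Prm ω = π})
    (hB : ∀ ω i, B ω i =
      if ∃ j : Fin k, (j : ℕ) < N ω ∧ Prm ω j = i then last else B' ω i) :
    ∀ b : Fin k → Fin n, P {ω | B ω = b} = (((n : ℝ≥0∞)) ^ k)⁻¹ := by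
  intro b
  classical
  set S := Finset.univ.filter fun i => b i = last with hS
  have hSk : S.card ≤ k := by simpa using S.card_le_univ
  let F := Finset.univ.filter fun b' : Fin k → Fin n =>
    (∀ i, b' i ≠ last) ∧ ∀ i, b i ≠ last → b' i = b i
  let G := Finset.univ.filter fun π : Equiv.Perm (Fin k) =>
    ∀ j : Fin k, (j : ℕ) < S.card ↔ π j ∈ S
  have hset : {ω | B ω = b} = ⋃ x ∈ F ×ˢ G,
      {ω | B' ω = x.1} ∩ {ω | N ω = S.card} ∩ {ω | Prm ω = x.2} := by
    ext ω
    have h := overwrite_eq_iff last (B' ω) b (N ω) (hNrange ω) (Prm ω) (hB'range ω)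
    simp only [Set.mem_ofPred_eq, funext_iff (f := B ω), hB, Set.mem_iUnion, Set.mem_inter_iff,
      exists_prop]
    rw [h]
    constructor
    · rintro ⟨h1, h2, h3⟩
      exact ⟨(B' ω, Prm ω), by simpa [F, G] using ⟨⟨hB'range ω, h1⟩, by simpa [hS] using h3⟩,
        ⟨rfl, h2⟩, rfl⟩
    · rintro ⟨⟨b', π⟩, hx, ⟨rfl, h2⟩, rfl⟩
      obtain ⟨hF, hG⟩ := Finset.mem_product.mp hx
      exact ⟨(Finset.mem_filter.mp hF).2.2, h2, (Finset.mem_filter.mp hG).2⟩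
  rw [hset, measure_biUnion_finset]
  · rw [Finset.sum_congr rfl (g := fun _ => ((((n - 1 : ℕ) : ℝ≥0∞)) ^ k)⁻¹ *
      ((k.choose S.card : ℝ≥0∞) * ((n : ℝ≥0∞)⁻¹) ^ S.card *
        (1 - (n : ℝ≥0∞)⁻¹) ^ (k - S.card)) * ((k.factorial : ℝ≥0∞))⁻¹)]
    · rw [Finset.sum_const, Finset.card_product, nsmul_eq_mul, card_agree_avoid last b,
        card_perm_image_initial k S]
      exact favourable_mass n k S.card hn hSk
    · intro x hx
      have hF := (Finset.mem_filter.mp (Finset.mem_product.mp hx).1).2.1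
      rw [hindep, hB'unif _ hF, hNdist _ hSk, hPrmunif]
  · intro x _ y _ hxy
    refine Set.disjoint_left.mpr ?_
    rintro ω ⟨⟨h1, _⟩, h2⟩ ⟨⟨h3, _⟩, h4⟩
    exact hxy (Prod.ext (h1.symm.trans h3) (h2.symm.trans h4))
  · exact fun x _ => ((hB'meas _).inter (hNmeas _)).inter (hPrmmeas _)
end

section
/- Let p, q, r be strictly positive probability densities with respect to a σ-finite measure λ on a measurable space, and let k ≥ 1 be an integer. Then ∫ ((p(θ) − q(θ))/r(θ))^k · r(θ) dλ(θ) ≤ D_{χ^k}(q‖p) + D_{χ^k}(p‖q) + D_{χ^k}(p‖r) + D_{χ^k}(q‖r) if k is even, and ∫ ((p(θ) − q(θ))/r(θ))^k · r(θ) dλ(θ) ≤ D_{χ^k}(q‖p) + D_{χ^k}(p‖q) + D_{χ^k}(p‖r) if k is odd. -/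
open MeasureTheory

noncomputable section

/-- the `χ^k` divergence between densities `f` and `g` w.r.t. the measure `lam`. -/
def chiDiv {Ω : Type*} [MeasurableSpace Ω] (lam : Measure Ω) (k : ℕ) (f g : Ω → ℝ) : ℝ :=
  ∫ θ, |f θ / g θ - 1| ^ k * g θ ∂lam

/-- Pointwise bound: for `q ≤ p`, either `q ≤ r` and the `χ^k` integrand of `(p, q)` dominates,
or `r < q` and that of `(p, r)` does. -/
theorem div_pow_mul_le_of_le {p q r : ℝ} (hq : 0 < q) (hr : 0 < r) (hqp : q ≤ p)
    {k : ℕ} (hk : 1 ≤ k) :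
    ((p - q) / r) ^ k * r ≤ |p / q - 1| ^ k * q + |p / r - 1| ^ k * r := by
  rcases le_or_gt q r with h | h
  · have key : ((p - q) / r) ^ k * r ≤ |p / q - 1| ^ k * q := by
      obtain ⟨n, rfl⟩ := Nat.exists_eq_add_of_le' hk
      have hpq : 0 ≤ p - q := sub_nonneg.2 hqp
      have e : p / q - 1 = (p - q) / q := by field_simp
      have aux : ∀ x : ℝ, 0 < x → ((p - q) / x) ^ (n + 1) * x = (p - q) ^ (n + 1) / x ^ n := by
        intro x hx
        rw [div_pow, pow_succ x]
        field_simp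
      rw [e, abs_of_nonneg (by positivity), aux r hr, aux q hq]
      gcongr
    have : 0 ≤ |p / r - 1| ^ k * r := by positivity
    linarith
  · have key : ((p - q) / r) ^ k * r ≤ |p / r - 1| ^ k * r := by
      have hpq : 0 ≤ (p - q) / r := div_nonneg (sub_nonneg.2 hqp) hr.le
      have e : p / r - 1 = (p - r) / r := by field_simp
      have : (p - q) / r ≤ |p / r - 1| := by
        rw [e]
        refine le_trans ?_ (le_abs_self _)
        gcongr
      gcongr
    have : 0 ≤ |p / q - 1| ^ k * q := by positivity
    linarith

/-- Lemma bounding `∫ ((p−q)/r)^k r` by `χ^k` divergences. -/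
theorem stmt10 {Ω : Type*} [MeasurableSpace Ω] (lam : Measure Ω) [SigmaFinite lam]
    (p q r : Ω → ℝ)
    (hp : ∀ θ, 0 < p θ) (hq : ∀ θ, 0 < q θ) (hr : ∀ θ, 0 < r θ)
    (hpd : ∫ θ, p θ ∂lam = 1) (hqd : ∫ θ, q θ ∂lam = 1) (hrd : ∫ θ, r θ ∂lam = 1)
    (k : ℕ) (hk : 1 ≤ k)
    (hint : Integrable (fun θ => ((p θ - q θ) / r θ) ^ k * r θ) lam)
    (h1 : Integrable (fun θ => |q θ / p θ - 1| ^ k * p θ) lam)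
    (h2 : Integrable (fun θ => |p θ / q θ - 1| ^ k * q θ) lam)
    (h3 : Integrable (fun θ => |p θ / r θ - 1| ^ k * r θ) lam)
    (h4 : Integrable (fun θ => |q θ / r θ - 1| ^ k * r θ) lam) :
    (Even k →
      ∫ θ, ((p θ - q θ) / r θ) ^ k * r θ ∂lam ≤
        chiDiv lam k q p + chiDiv lam k p q + chiDiv lam k p r + chiDiv lam k q r) ∧
    (Odd k →
      ∫ θ, ((p θ - q θ) / r θ) ^ k * r θ ∂lam ≤
        chiDiv lam k q p + chiDiv lam k p q + chiDiv lam k p r) := by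
  unfold chiDiv
  constructor
  · intro hke
    rw [← integral_add' h1 h2, ← integral_add' (h1.add h2) h3,
      ← integral_add' ((h1.add h2).add h3) h4]
    refine integral_mono hint (((h1.add h2).add h3).add h4) fun θ => ?_
    have hp := hp θ
    have hq := hq θ
    have hr := hr θ
    have n1 : 0 ≤ |q θ / p θ - 1| ^ k * p θ := by positivity
    have n2 : 0 ≤ |p θ / q θ - 1| ^ k * q θ := by positivity
    have n3 : 0 ≤ |p θ / r θ - 1| ^ k * r θ := by positivity
    have n4 : 0 ≤ |q θ / r θ - 1| ^ k * r θ := by positivity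
    simp only [Pi.add_apply]
    rcases le_total (q θ) (p θ) with h | h
    · linarith [div_pow_mul_le_of_le hq hr h hk]
    · have e : ((p θ - q θ) / r θ) ^ k = ((q θ - p θ) / r θ) ^ k := by
        rw [← neg_sub, neg_div, hke.neg_pow]
      rw [e]
      linarith [div_pow_mul_le_of_le hp hr h hk]
  · intro hko
    rw [← integral_add' h1 h2, ← integral_add' (h1.add h2) h3]
    refine integral_mono hint ((h1.add h2).add h3) fun θ => ?_
    have hp := hp θ
    have hq := hq θ
    have hr := hr θ
    have n1 : 0 ≤ |q θ / p θ - 1| ^ k * p θ := by positivity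
    have n2 : 0 ≤ |p θ / q θ - 1| ^ k * q θ := by positivity
    have n3 : 0 ≤ |p θ / r θ - 1| ^ k * r θ := by positivity
    simp only [Pi.add_apply]
    rcases le_total (q θ) (p θ) with h | h
    · linarith [div_pow_mul_le_of_le hq hr h hk]
    · have hneg : ((p θ - q θ) / r θ) ^ k * r θ ≤ 0 :=
        mul_nonpos_of_nonpos_of_nonneg
          (hko.pow_nonpos (div_nonpos_of_nonpos_of_nonneg (sub_nonpos.2 h) hr.le)) hr.le
      linarith
end
end

section
/- Let r > 0, s > 0, and set σ = 2s/r. For every integer k ≥ 1 and all vectors u, v ∈ ℝ^p: if ‖u‖ ≤ r then ∫_{ℝ^p} |N_{u,s²}(θ)/N_{0,s²}(θ) − 1|^k · N_{0,s²}(θ) dθ ≤ B̃_{σ,k}; and if ‖u − v‖ ≤ r then ∫_{ℝ^p} |N_{u,s²}(θ)/N_{v,s²}(θ) − 1|^k · N_{v,s²}(θ) dθ ≤ B̃_{σ,k}. -/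
open MeasureTheory Finset

noncomputable section

/-- Isotropic Gaussian density on a finite-dimensional inner product space. -/
def isoGauss {E : Type*} [NormedAddCommGroup E] [InnerProductSpace ℝ E] (μ : E) (s : ℝ)
    (x : E) : ℝ :=
  (2 * Real.pi * s ^ 2) ^ (-(Module.finrank ℝ E : ℝ) / 2) *
    Real.exp (-‖x - μ‖ ^ 2 / (2 * s ^ 2))

lemma gaussND_eq_isoGauss {p : ℕ} (μ : EuclideanSpace ℝ (Fin p)) (s : ℝ) :
    gaussND μ s = isoGauss μ s := by
  funext x
  simp [gaussND, isoGauss]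

lemma gauss1_eq_isoGauss (μ s : ℝ) : gauss1 μ s = isoGauss μ s := by
  funext x
  simp [gauss1, isoGauss]

/-- The `k`-th central moment of a log-normal likelihood ratio with log-variance `t`. -/
def chiMoment (k : ℕ) (t : ℝ) : ℝ :=
  ∑ j ∈ range (k + 1), Real.exp (t * (j * (j - 1) / 2)) * (-1) ^ (k - j) * (k.choose j : ℝ)

section IsoGauss

variable {E : Type*} [NormedAddCommGroup E] [InnerProductSpace ℝ E]

lemma isoGauss_pos {s : ℝ} (hs : 0 < s) (μ x : E) : 0 < isoGauss μ s x := by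
  unfold isoGauss
  positivity

lemma isoGauss_ratio_pow_mul {s : ℝ} (hs : 0 < s) (u v x : E) (j : ℕ) :
    (isoGauss u s x / isoGauss v s x) ^ j * isoGauss v s x =
      Real.exp (‖u - v‖ ^ 2 / s ^ 2 * (j * (j - 1) / 2)) *
        isoGauss (v + (j : ℝ) • (u - v)) s x := by
  have hc : (0 : ℝ) < (2 * Real.pi * s ^ 2) ^ (-(Module.finrank ℝ E : ℝ) / 2) := by positivity
  unfold isoGauss
  rw [mul_div_mul_left _ _ hc.ne', ← Real.exp_sub, ← Real.exp_nat_mul, mul_left_comm,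
    mul_left_comm (Real.exp (‖u - v‖ ^ 2 / s ^ 2 * (j * (j - 1) / 2))), ← Real.exp_add,
    ← Real.exp_add]
  congr 2
  have h₁ : ‖x - u‖ ^ 2 = ‖x - v‖ ^ 2 - 2 * inner ℝ (x - v) (u - v) + ‖u - v‖ ^ 2 := by
    rw [← norm_sub_sq_real, sub_sub_sub_cancel_right]
  have h₂ : ‖x - (v + (j : ℝ) • (u - v))‖ ^ 2 =
      ‖x - v‖ ^ 2 - 2 * (j * inner ℝ (x - v) (u - v)) + j ^ 2 * ‖u - v‖ ^ 2 := by
    rw [← sub_sub, norm_sub_sq_real, inner_smul_right, norm_smul, mul_pow, Real.norm_eq_abs,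
      sq_abs]
  rw [h₁, h₂]
  field_simp
  ring

lemma isoGauss_affine_pow_mul {s : ℝ} (hs : 0 < s) (c : ℝ) (u v x : E) (k : ℕ) :
    (c * (isoGauss u s x / isoGauss v s x) - 1) ^ k * isoGauss v s x =
      ∑ j ∈ range (k + 1), c ^ j * Real.exp (‖u - v‖ ^ 2 / s ^ 2 * (j * (j - 1) / 2)) *
        (-1) ^ (k - j) * (k.choose j : ℝ) * isoGauss (v + (j : ℝ) • (u - v)) s x := by
  rw [sub_eq_add_neg, add_pow, sum_mul]
  refine sum_congr rfl fun j _ => ?_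
  linear_combination c ^ j * (-1) ^ (k - j) * (k.choose j : ℝ) * isoGauss_ratio_pow_mul hs u v x j

variable [FiniteDimensional ℝ E] [MeasurableSpace E] [BorelSpace E]

lemma integral_isoGauss {s : ℝ} (hs : 0 < s) (μ : E) : ∫ x, isoGauss μ s x = 1 := by
  have h := GaussianFourier.integral_rexp_neg_mul_sq_norm (V := E) (b := 1 / (2 * s ^ 2))
    (by positivity)
  have hsub := integral_sub_right_eq_self (μ := (volume : Measure E))
    (fun x => Real.exp (-(1 / (2 * s ^ 2)) * ‖x‖ ^ 2)) μ
  have he : ∀ x : E, isoGauss μ s x = (2 * Real.pi * s ^ 2) ^ (-(Module.finrank ℝ E : ℝ) / 2) *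
      Real.exp (-(1 / (2 * s ^ 2)) * ‖x - μ‖ ^ 2) := fun x => by
    rw [isoGauss]
    congr 2
    ring
  simp_rw [he]
  rw [integral_const_mul, hsub, h, show Real.pi / (1 / (2 * s ^ 2)) = 2 * Real.pi * s ^ 2 by
    field_simp, ← Real.rpow_add (by positivity)]
  ring_nf
  exact Real.rpow_zero _

lemma integrable_isoGauss {s : ℝ} (hs : 0 < s) (μ : E) : Integrable (isoGauss μ s) :=
  .of_integral_ne_zero (by rw [integral_isoGauss hs]; exact one_ne_zero)

lemma integrable_isoGauss_affine {s : ℝ} (hs : 0 < s) (c : ℝ) (u v : E) (k : ℕ) :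
    Integrable fun x => (c * (isoGauss u s x / isoGauss v s x) - 1) ^ k * isoGauss v s x := by
  simp_rw [isoGauss_affine_pow_mul hs]
  exact integrable_finsetSum _ fun j _ => (integrable_isoGauss hs _).const_mul _

lemma integral_isoGauss_affine {s : ℝ} (hs : 0 < s) (c : ℝ) (u v : E) (k : ℕ) :
    ∫ x, (c * (isoGauss u s x / isoGauss v s x) - 1) ^ k * isoGauss v s x =
      ∑ j ∈ range (k + 1), c ^ j * Real.exp (‖u - v‖ ^ 2 / s ^ 2 * (j * (j - 1) / 2)) *
        (-1) ^ (k - j) * (k.choose j : ℝ) := by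
  simp_rw [isoGauss_affine_pow_mul hs]
  rw [integral_finsetSum _ fun j _ => (integrable_isoGauss hs _).const_mul _]
  simp_rw [integral_const_mul, integral_isoGauss hs, mul_one]

lemma integrable_isoGauss_ratio_sub_one {s : ℝ} (hs : 0 < s) (u v : E) (k : ℕ) :
    Integrable fun x => (isoGauss u s x / isoGauss v s x - 1) ^ k * isoGauss v s x := by
  simpa using integrable_isoGauss_affine hs 1 u v k

lemma integral_isoGauss_ratio_sub_one {s : ℝ} (hs : 0 < s) (u v : E) (k : ℕ) :
    ∫ x, (isoGauss u s x / isoGauss v s x - 1) ^ k * isoGauss v s x =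
      chiMoment k (‖u - v‖ ^ 2 / s ^ 2) := by
  simpa [chiMoment] using integral_isoGauss_affine hs 1 u v k

/-- Cauchy–Schwarz for consecutive absolute moments of the likelihood ratio. -/
lemma sq_integral_abs_isoGauss_le {s : ℝ} (hs : 0 < s) (u v : E) {n : ℕ} (hn : Even n) :
    (∫ x, |isoGauss u s x / isoGauss v s x - 1| ^ (n + 1) * isoGauss v s x) ^ 2 ≤
      chiMoment n (‖u - v‖ ^ 2 / s ^ 2) * chiMoment (n + 2) (‖u - v‖ ^ 2 / s ^ 2) := by
  have habs : Integrable fun x =>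
      |isoGauss u s x / isoGauss v s x - 1| ^ (n + 1) * isoGauss v s x := by
    refine (integrable_isoGauss_ratio_sub_one hs u v (n + 1)).abs.congr (.of_forall fun x => ?_)
    simp only [abs_mul, abs_pow, abs_of_pos (isoGauss_pos hs v x)]
  have hd := discrim_le_zero (a := chiMoment n (‖u - v‖ ^ 2 / s ^ 2))
    (b := -2 * ∫ x, |isoGauss u s x / isoGauss v s x - 1| ^ (n + 1) * isoGauss v s x)
    (c := chiMoment (n + 2) (‖u - v‖ ^ 2 / s ^ 2)) fun y => by
      have hsq := (integrable_isoGauss_ratio_sub_one hs u v n).const_mul (y * y)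
      have hlin := habs.const_mul (-2 * y)
      rw [← integral_isoGauss_ratio_sub_one hs, ← integral_isoGauss_ratio_sub_one hs,
        mul_comm _ (y * y), mul_right_comm (-2), ← integral_const_mul, ← integral_const_mul,
        ← integral_add hsq hlin, ← integral_add (by exact hsq.add hlin)
          (integrable_isoGauss_ratio_sub_one hs u v (n + 2))]
      refine integral_nonneg fun x => ?_
      have hg := (isoGauss_pos hs v x).le
      set X := isoGauss u s x / isoGauss v s x - 1
      have hX : 0 ≤ |X| ^ n * (y - |X|) ^ 2 * isoGauss v s x := by positivity
      rw [← hn.pow_abs X, ← (hn.add even_two).pow_abs X]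
      simp only [Pi.zero_apply]
      linarith [show |X| ^ n * (y - |X|) ^ 2 * isoGauss v s x =
        y * y * (|X| ^ n * isoGauss v s x) + -2 * y * (|X| ^ (n + 1) * isoGauss v s x) +
          |X| ^ (n + 2) * isoGauss v s x by ring]
  rw [discrim] at hd
  linarith

end IsoGauss

lemma chiMoment_nonneg {k : ℕ} (hk : Even k) {t : ℝ} (ht : 0 ≤ t) : 0 ≤ chiMoment k t := by
  have h := integral_isoGauss_ratio_sub_one one_pos (√t) 0 k
  rw [sub_zero, Real.norm_eq_abs, sq_abs, Real.sq_sqrt ht, one_pow, div_one] at h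
  rw [← h]
  exact integral_nonneg fun x => mul_nonneg (hk.pow_nonneg _) (isoGauss_pos one_pos _ _).le

/-- The derivative in `t` is a positive multiple of an even moment of `exp (2 * t) * L - 1`. -/
lemma deriv_chiMoment_nonneg {n : ℕ} (hn : Even n) {t : ℝ} (ht : 0 ≤ t) :
    0 ≤ ∑ j ∈ range (n + 2 + 1), Real.exp (t * (j * (j - 1) / 2)) * (j * (j - 1) / 2) *
      (-1) ^ (n + 2 - j) * ((n + 2).choose j : ℝ) := by
  have h := integral_isoGauss_affine one_pos (Real.exp (2 * t)) (√t) 0 n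
  rw [sub_zero, Real.norm_eq_abs, sq_abs, Real.sq_sqrt ht, one_pow, div_one] at h
  have h₀ : 0 ≤ ∫ x, (Real.exp (2 * t) * (isoGauss (√t) 1 x / isoGauss 0 1 x) - 1) ^ n *
      isoGauss 0 1 x :=
    integral_nonneg fun x => mul_nonneg (hn.pow_nonneg _) (isoGauss_pos one_pos _ _).le
  rw [h] at h₀
  rw [sum_range_succ', sum_range_succ']
  have hsum : ∑ j ∈ range (n + 1), Real.exp (t * (((j + 1 + 1 : ℕ) : ℝ) *
        (((j + 1 + 1 : ℕ) : ℝ) - 1) / 2)) *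
        (((j + 1 + 1 : ℕ) : ℝ) * (((j + 1 + 1 : ℕ) : ℝ) - 1) / 2) *
        (-1) ^ (n + 2 - (j + 1 + 1)) * ((n + 2).choose (j + 1 + 1) : ℝ) =
      (n + 2) * (n + 1) / 2 * Real.exp t * ∑ j ∈ range (n + 1), Real.exp (2 * t) ^ j *
        Real.exp (t * (j * (j - 1) / 2)) * (-1) ^ (n - j) * (n.choose j : ℝ) := by
    rw [mul_sum]
    refine sum_congr rfl fun j _ => ?_
    have hch : ((n + 2).choose (j + 1 + 1) : ℝ) * ((j + 2) * (j + 1)) =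
        (n + 2) * (n + 1) * n.choose j := by
      have h₁ := Nat.add_one_mul_choose_eq (n + 1) (j + 1)
      have h₂ := Nat.add_one_mul_choose_eq n j
      have h₁' : ((n : ℝ) + 1 + 1) * (n + 1).choose (j + 1) =
        (n + 2).choose (j + 1 + 1) * (j + 1 + 1) := by exact_mod_cast h₁
      have h₂' : ((n : ℝ) + 1) * n.choose j = (n + 1).choose (j + 1) * (j + 1) := by
        exact_mod_cast h₂
      linear_combination -(j + 1) * h₁' - (n + 2) * h₂'
    have hexp : Real.exp (t * (((j + 1 + 1 : ℕ) : ℝ) * (((j + 1 + 1 : ℕ) : ℝ) - 1) / 2)) =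
        Real.exp t * (Real.exp (2 * t) ^ j * Real.exp (t * (j * (j - 1) / 2))) := by
      rw [← Real.exp_nat_mul, ← Real.exp_add, ← Real.exp_add]
      congr 1
      push_cast
      ring
    rw [hexp, show n + 2 - (j + 1 + 1) = n - j by omega]
    push_cast
    linear_combination Real.exp t * (Real.exp (2 * t) ^ j * Real.exp (t * (j * (j - 1) / 2))) *
      (-1) ^ (n - j) / 2 * hch
  rw [hsum]
  simp only [Nat.cast_zero, zero_add, Nat.cast_one, sub_self, mul_zero, zero_mul, zero_div,
    add_zero]
  positivity

lemma chiMoment_mono {k : ℕ} (hk : Even k) {t t' : ℝ} (ht : 0 ≤ t) (htt' : t ≤ t') :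
    chiMoment k t ≤ chiMoment k t' := by
  obtain rfl | ⟨n, rfl⟩ : k = 0 ∨ ∃ n, k = n + 2 := by
    rcases k with _ | _ | n
    · exact .inl rfl
    · exact absurd hk (by decide)
    · exact .inr ⟨n, rfl⟩
  · simp [chiMoment]
  have hn : Even n := by simpa [Nat.even_add] using hk
  have hderiv (x : ℝ) : HasDerivAt (chiMoment (n + 2))
      (∑ j ∈ range (n + 2 + 1), Real.exp (x * (j * (j - 1) / 2)) * (j * (j - 1) / 2) *
        (-1) ^ (n + 2 - j) * ((n + 2).choose j : ℝ)) x := by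
    unfold chiMoment
    refine HasDerivAt.fun_sum fun j _ => ?_
    exact ((hasDerivAt_mul_const _).exp.mul_const _).mul_const _
  refine monotoneOn_of_deriv_nonneg (convex_Ici 0)
    (fun x _ => (hderiv x).continuousAt.continuousWithinAt)
    (fun x _ => (hderiv x).differentiableAt.differentiableWithinAt) (fun x hx => ?_)
    ht (ht.trans htt') htt'
  rw [(hderiv x).deriv]
  rw [interior_Ici] at hx
  exact deriv_chiMoment_nonneg hn (le_of_lt hx)

lemma Mcoef_eq_chiMoment {r s : ℝ} (hr : 0 < r) (hs : 0 < s) (k : ℕ) :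
    Mcoef (2 * s / r) k = chiMoment k (r ^ 2 / s ^ 2) := by
  have hσ : 0 < 2 * s / r / 2 := by positivity
  simp_rw [Mcoef, gauss1_eq_isoGauss]
  rw [integral_isoGauss_ratio_sub_one hσ]
  congr 1
  simp only [sub_zero, norm_one]
  field_simp

lemma integral_gaussND_ratio_le_Btil {p : ℕ} {r s : ℝ} (hr : 0 < r) (hs : 0 < s)
    {u v : EuclideanSpace ℝ (Fin p)} (huv : ‖u - v‖ ≤ r) (k : ℕ) :
    ∫ θ, |gaussND u s θ / gaussND v s θ - 1| ^ k * gaussND v s θ ≤ Btil (2 * s / r) k := by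
  have ht : 0 ≤ ‖u - v‖ ^ 2 / s ^ 2 := by positivity
  have htt' : ‖u - v‖ ^ 2 / s ^ 2 ≤ r ^ 2 / s ^ 2 := by gcongr
  simp_rw [gaussND_eq_isoGauss, Btil, Mcoef_eq_chiMoment hr hs]
  split_ifs with hk
  · simp_rw [hk.pow_abs]
    rw [integral_isoGauss_ratio_sub_one hs]
    exact chiMoment_mono hk ht htt'
  · obtain ⟨n, rfl⟩ : ∃ n, k = n + 1 := Nat.exists_eq_succ_of_ne_zero (by rintro rfl; simp at hk)
    have hn : Even n := by simpa [Nat.even_add_one] using hk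
    have hn₂ : Even (n + 2) := hn.add even_two
    refine Real.le_sqrt_of_sq_le ((sq_integral_abs_isoGauss_le hs u v hn).trans ?_)
    exact mul_le_mul (chiMoment_mono hn ht htt') (chiMoment_mono hn₂ ht htt')
      (chiMoment_nonneg hn₂ ht) (chiMoment_nonneg hn (ht.trans htt'))

/-- uniform bound on `χ^k`-type Gaussian integrals by `B̃_{σ,k}`. -/
theorem stmt11 {pd : ℕ} (r s : ℝ) (hr : 0 < r) (hs : 0 < s)
    (u v : EuclideanSpace ℝ (Fin pd)) (k : ℕ) (hk : 1 ≤ k) :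
    (‖u‖ ≤ r →
      ∫ θ : EuclideanSpace ℝ (Fin pd),
          |gaussND u s θ / gaussND 0 s θ - 1| ^ k * gaussND 0 s θ ≤
        Btil (2 * s / r) k) ∧
    (‖u - v‖ ≤ r →
      ∫ θ : EuclideanSpace ℝ (Fin pd),
          |gaussND u s θ / gaussND v s θ - 1| ^ k * gaussND v s θ ≤
        Btil (2 * s / r) k) := by
  exact ⟨fun hu => integral_gaussND_ratio_le_Btil hr hs (by rwa [sub_zero]) k,
    fun huv => integral_gaussND_ratio_le_Btil hr hs huv k⟩
end
end

section
/- For every σ > 0 and every integer k ≥ 0, M_{σ,k} = Σ_{ℓ=0}^{k} (−1)^{k−ℓ}·binom(k,ℓ)·e^{2ℓ(ℓ−1)/σ²}; equivalently, M_{σ,k} = Σ_{ℓ=2}^{k} (−1)^{k−ℓ}·binom(k,ℓ)·e^{2ℓ(ℓ−1)/σ²} + (−1)^{k−1}·(k−1). In particular M_{σ,0} = 1, M_{σ,1} = 0, and M_{σ,2} = e^{4/σ²} − 1. -/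
open MeasureTheory Finset

noncomputable section

theorem gauss1_eq_gaussianPDFReal (μ s : ℝ) :
    gauss1 μ s = ProbabilityTheory.gaussianPDFReal μ (s ^ 2).toNNReal := by
  ext θ
  have hs : 0 ≤ 2 * Real.pi * s ^ 2 := by positivity
  rw [gauss1, ProbabilityTheory.gaussianPDFReal, Real.coe_toNNReal _ (sq_nonneg s),
    Real.sqrt_eq_rpow, ← Real.rpow_neg hs]
  norm_num

theorem integrable_gauss1 (μ s : ℝ) : Integrable (gauss1 μ s) := by
  rw [gauss1_eq_gaussianPDFReal]
  exact ProbabilityTheory.integrable_gaussianPDFReal μ _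

theorem integral_gauss1 (μ : ℝ) {s : ℝ} (hs : s ≠ 0) : ∫ θ, gauss1 μ s θ = 1 := by
  rw [gauss1_eq_gaussianPDFReal]
  refine ProbabilityTheory.integral_gaussianPDFReal_eq_one μ ?_
  exact (Real.toNNReal_pos.2 (by positivity)).ne'

/-- Tilting a centred Gaussian by the `ℓ`-th power of a likelihood ratio shifts its mean to `ℓ`. -/
theorem gauss1_ratio_pow_mul {σ : ℝ} (hσ : σ ≠ 0) (ℓ : ℕ) (θ : ℝ) :
    (gauss1 1 (σ / 2) θ / gauss1 0 (σ / 2) θ) ^ ℓ * gauss1 0 (σ / 2) θ =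
      Real.exp (2 * ℓ * ((ℓ : ℝ) - 1) / σ ^ 2) * gauss1 ℓ (σ / 2) θ := by
  have hc : (2 * Real.pi * (σ / 2) ^ 2) ^ (-(1 : ℝ) / 2) ≠ 0 :=
    (Real.rpow_pos_of_pos (by positivity) _).ne'
  simp only [gauss1]
  rw [mul_div_mul_left _ _ hc, ← Real.exp_sub, ← Real.exp_nat_mul, mul_left_comm,
    mul_left_comm (Real.exp (2 * _ * _ / _)), ← Real.exp_add, ← Real.exp_add]
  congr 2
  field_simp
  ring

theorem Mcoef_eq_sum {σ : ℝ} (hσ : σ ≠ 0) (k : ℕ) :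
    Mcoef σ k = ∑ ℓ ∈ Finset.range (k + 1),
      (-1 : ℝ) ^ (k - ℓ) * (k.choose ℓ : ℝ) * Real.exp (2 * ℓ * ((ℓ : ℝ) - 1) / σ ^ 2) := by
  have h (θ : ℝ) :
      (gauss1 1 (σ / 2) θ / gauss1 0 (σ / 2) θ - 1) ^ k * gauss1 0 (σ / 2) θ =
        ∑ ℓ ∈ Finset.range (k + 1), (-1 : ℝ) ^ (k - ℓ) * (k.choose ℓ : ℝ) *
          Real.exp (2 * ℓ * ((ℓ : ℝ) - 1) / σ ^ 2) * gauss1 ℓ (σ / 2) θ := by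
    rw [sub_eq_add_neg, add_pow, Finset.sum_mul]
    refine Finset.sum_congr rfl fun ℓ _ => ?_
    linear_combination (-1 : ℝ) ^ (k - ℓ) * (k.choose ℓ : ℝ) * gauss1_ratio_pow_mul hσ ℓ θ
  simp only [Mcoef, h]
  rw [integral_finsetSum _ fun ℓ _ => (integrable_gauss1 _ _).const_mul _]
  refine Finset.sum_congr rfl fun ℓ _ => ?_
  rw [integral_const_mul, integral_gauss1 _ (by positivity), mul_one]

/-- closed-form evaluation of `M_{σ,k}`. -/
theorem stmt13 (σ : ℝ) (hσ : 0 < σ) (k : ℕ) :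
    (Mcoef σ k = ∑ ℓ ∈ Finset.range (k + 1),
        (-1 : ℝ) ^ (k - ℓ) * (k.choose ℓ : ℝ) * Real.exp (2 * ℓ * ((ℓ : ℝ) - 1) / σ ^ 2)) ∧
    (Mcoef σ k = (∑ ℓ ∈ Finset.Icc 2 k,
        (-1 : ℝ) ^ (k - ℓ) * (k.choose ℓ : ℝ) * Real.exp (2 * ℓ * ((ℓ : ℝ) - 1) / σ ^ 2)) +
      (-1 : ℝ) ^ ((k : ℤ) - 1) * ((k : ℝ) - 1)) ∧
    Mcoef σ 0 = 1 ∧ Mcoef σ 1 = 0 ∧ Mcoef σ 2 = Real.exp (4 / σ ^ 2) - 1 := by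
  have h := Mcoef_eq_sum hσ.ne'
  refine ⟨h k, ?_, ?_, ?_, ?_⟩
  · rw [h]
    rcases k with _ | _ | n
    · simp
    · simp [Finset.sum_range_succ]
    · rw [Finset.range_eq_Ico, Finset.sum_eq_sum_Ico_succ_bot (by lia),
        Finset.sum_eq_sum_Ico_succ_bot (by lia), Finset.Ico_add_one_right_eq_Icc]
      have hz : (-1 : ℝ) ^ (((n + 1 + 1 : ℕ) : ℤ) - 1) = (-1) ^ (n + 1) := by
        rw [← zpow_natCast]
        congr 1
        push_cast
        ring
      rw [hz]
      simp
      ring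
  · simp [h]
  · simp [h, Finset.sum_range_succ]
  · rw [h]
    norm_num [Finset.sum_range_succ]
    ring
end
end
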